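/- Let S = {a, a', b, b'} be a four-letter alphabet with complementation, let d ∈ {5, 6}, and let V, W ⊆ S^d be disjoint equivalent polybox codes without twin pairs with |V| ∈ {13,...,16}. For every i ∈ [d] and every l, s ∈ S with l ∉ {s, s'}, if 4 ≤ |V^{i,l} ∪ V^{i,s}| ≤ 10, then the code V^{i,l} ∪ V^{i,s} contains a pair of i-siblings. -/

import Mathlib

/-- The four-letter alphabet `S = {a, a', b, b'}` is modelled as `Fin 4` with
`a = 0, a' = 1, b = 2, b' = 3`; the complementation swaps `0 ↔ 1` and `2 ↔ 3`. -/
def compl4 : Fin 4 → Fin 4 := ![1, 0, 3, 2]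

/-- Two words `u, v ∈ S^d` are dichotomous if `v j = (u j)'` for some coordinate `j`. -/
def Dichotomous {S : Type*} (c : S → S) {d : ℕ} (u v : Fin d → S) : Prop :=
  ∃ j, v j = c (u j)

/-- Two words form a twin pair if they differ by complementation at exactly one
coordinate and agree elsewhere. -/
def TwinPair {S : Type*} (c : S → S) {d : ℕ} (u v : Fin d → S) : Prop :=
  ∃ j, v j = c (u j) ∧ ∀ i, i ≠ j → u i = v i

/-- A polybox code: a set of pairwise dichotomous words. -/
def PolyboxCode {S : Type*} (c : S → S) {d : ℕ} (V : Finset (Fin d → S)) : Prop :=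
  ∀ u ∈ V, ∀ v ∈ V, u ≠ v → Dichotomous c u v

/-- A code without twin pairs. -/
def TwinPairFree {S : Type*} (c : S → S) {d : ℕ} (V : Finset (Fin d → S)) : Prop :=
  ∀ u ∈ V, ∀ v ∈ V, ¬ TwinPair c u v

/-- `ES`: the collection of all `B ⊆ S` containing exactly one letter from each
complementary pair `{s, s'}`. -/
def ESet {S : Type*} (c : S → S) : Set (Set S) :=
  {B | ∀ s : S, Xor' (s ∈ B) (c s ∈ B)}

/-- The equicomplementary realization `v̆ = Ev₁ × ⋯ × Ev_d` of a word `v`,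
where `Es = {B ∈ ES : s ∈ B}`. -/
def WordBox {S : Type*} (c : S → S) {d : ℕ} (v : Fin d → S) : Set (Fin d → Set S) :=
  {x | ∀ i, x i ∈ ESet c ∧ v i ∈ x i}

/-- `⋃ E(V)`, the union of the equicomplementary realizations of the words of `V`. -/
def CodeReal {S : Type*} (c : S → S) {d : ℕ} (V : Finset (Fin d → S)) :
    Set (Fin d → Set S) :=
  ⋃ v ∈ V, WordBox c v

/-- The word `w` is covered by the code `V`, i.e. `w̆ ⊆ ⋃ E(V)`. -/
def Covered {S : Type*} (c : S → S) {d : ℕ} (w : Fin d → S)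
    (V : Finset (Fin d → S)) : Prop :=
  WordBox c w ⊆ CodeReal c V

/-- Codes `V` and `W` are equivalent: `⋃ E(V) = ⋃ E(W)`. -/
def EquivalentCodes {S : Type*} (c : S → S) {d : ℕ} (V W : Finset (Fin d → S)) : Prop :=
  CodeReal c V = CodeReal c W

/-- Two dichotomous words `v, u` are `i`-siblings if `v i ∉ {u i, (u i)'}` and the
words `v_{i^c}, u_{i^c}` (with the `i`-th letter deleted) form a twin pair. -/
def ISiblings {S : Type*} (c : S → S) {d : ℕ} (i : Fin d) (v u : Fin d → S) : Prop :=
  Dichotomous c v u ∧ v i ≠ u i ∧ v i ≠ c (u i) ∧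
    ∃ j, j ≠ i ∧ u j = c (v j) ∧ ∀ k, k ≠ i → k ≠ j → v k = u k

namespace PB

abbrev Wd (m : ℕ) := Fin m → Fin 4

def Cr (p q : Fin 4) : Prop := q ≠ p ∧ q ≠ compl4 p

instance (p q : Fin 4) : Decidable (Cr p q) := by unfold Cr; infer_instance

theorem cc : ∀ a, compl4 (compl4 a) = a := by decide
theorem cne : ∀ a, compl4 a ≠ a := by decide
theorem cinj {a b : Fin 4} (h : compl4 a = compl4 b) : a = b := by
  rw [← cc a, h, cc]
theorem Cr.symm {p q : Fin 4} (h : Cr p q) : Cr q p := by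
  revert p q; decide
theorem Cr.compl {p q : Fin 4} (h : Cr p q) : Cr p (compl4 q) := by
  revert p q; decide
theorem Cr.compl_left {p q : Fin 4} (h : Cr p q) : Cr (compl4 p) q := by
  revert p q; decide
theorem Cr.or {p q r : Fin 4} (h : Cr p q) (h' : Cr p r) : r = q ∨ r = compl4 q := by
  revert p q r; decide
theorem tri (p q : Fin 4) : q = p ∨ q = compl4 p ∨ Cr p q := by
  revert p q; decide
theorem exCr (p : Fin 4) : ∃ q, Cr p q := by revert p; decide
theorem cases4 {p q : Fin 4} (h : Cr p q) (r : Fin 4) :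
    r = p ∨ r = q ∨ r = compl4 p ∨ r = compl4 q := by
  revert p q r; decide

def Pt {m : ℕ} (x t : Wd m) : Prop := ∀ j, Cr (x j) (t j)
def In {m : ℕ} (v x t : Wd m) : Prop := ∀ j, v j = x j ∨ v j = t j
def CovW {m : ℕ} (C : Finset (Wd m)) (x : Wd m) : Prop :=
  ∀ t, Pt x t → ∃ c ∈ C, In c x t
def Eqv {m : ℕ} (V W : Finset (Wd m)) : Prop :=
  ∀ x t, Pt x t → ((∃ v ∈ V, In v x t) ↔ ∃ w ∈ W, In w x t)

theorem Eqv.symm {m : ℕ} {V W : Finset (Wd m)} (h : Eqv V W) : Eqv W V :=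
  fun x t hp => (h x t hp).symm

theorem in_self {m : ℕ} (x t : Wd m) : In x x t := fun _ => Or.inl rfl

theorem Eqv.cov {m : ℕ} {V W : Finset (Wd m)} (h : Eqv V W) {x : Wd m} (hx : x ∈ W) :
    CovW V x := fun t ht => (h x t ht).2 ⟨x, hx, in_self x t⟩

theorem dich_symm {m : ℕ} {u v : Wd m} (h : Dichotomous compl4 u v) : Dichotomous compl4 v u := by
  obtain ⟨j, hj⟩ := h
  exact ⟨j, by rw [hj, cc]⟩

theorem twin_symm {m : ℕ} {u v : Wd m} (h : TwinPair compl4 u v) : TwinPair compl4 v u := by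
  obtain ⟨j, hj, h2⟩ := h
  exact ⟨j, by rw [hj, cc], fun i hi => (h2 i hi).symm⟩

theorem dich_irrefl {m : ℕ} {u : Wd m} (h : Dichotomous compl4 u u) : False := by
  obtain ⟨j, hj⟩ := h
  exact cne _ hj.symm

theorem in_not_dich {m : ℕ} {u v x t : Wd m} (hp : Pt x t) (hu : In u x t) (hv : In v x t) :
    ¬ Dichotomous compl4 u v := by
  rintro ⟨j, hj⟩
  have h1 := hp j
  have h2 := hu j
  have h3 := hv j
  revert h1 h2 h3 hj
  generalize u j = a
  generalize v j = b
  generalize x j = e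
  generalize t j = f
  revert a b e f
  decide

theorem code_eq {m : ℕ} {C : Finset (Wd m)} (hC : PolyboxCode compl4 C) {u v x t : Wd m}
    (hu : u ∈ C) (hv : v ∈ C) (hp : Pt x t) (h1 : In u x t) (h2 : In v x t) : u = v := by
  by_contra h
  exact in_not_dich hp h1 h2 (hC u hu v hv h)

theorem Eqv_sdiff {m : ℕ} {V W : Finset (Wd m)} (hV : PolyboxCode compl4 V)
    (hW : PolyboxCode compl4 W) (h : Eqv V W) : Eqv (V \ W) (W \ V) := by
  intro x t hp
  constructor
  · rintro ⟨v, hv, hi⟩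
    rw [Finset.mem_sdiff] at hv
    obtain ⟨w, hw, hi'⟩ := (h x t hp).1 ⟨v, hv.1, hi⟩
    refine ⟨w, Finset.mem_sdiff.2 ⟨hw, fun hwV => hv.2 ?_⟩, hi'⟩
    rwa [code_eq hV hv.1 hwV hp hi hi']
  · rintro ⟨v, hv, hi⟩
    rw [Finset.mem_sdiff] at hv
    obtain ⟨w, hw, hi'⟩ := (h x t hp).2 ⟨v, hv.1, hi⟩
    refine ⟨w, Finset.mem_sdiff.2 ⟨hw, fun hwV => hv.2 ?_⟩, hi'⟩
    rwa [code_eq hW hv.1 hwV hp hi hi']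

theorem code_mono {m : ℕ} {V W : Finset (Wd m)} (h : V ⊆ W) (hW : PolyboxCode compl4 W) :
    PolyboxCode compl4 V := fun u hu v hv => hW u (h hu) v (h hv)
theorem tf_mono {m : ℕ} {V W : Finset (Wd m)} (h : V ⊆ W) (hW : TwinPairFree compl4 W) :
    TwinPairFree compl4 V := fun u hu v hv => hW u (h hu) v (h hv)

/-! slices -/

abbrev ins {m : ℕ} (i : Fin (m+1)) (l : Fin 4) (x : Wd m) : Wd (m+1) :=
  Fin.insertNth (α := fun _ => Fin 4) i l x

def sl {m : ℕ} (i : Fin (m+1)) (l : Fin 4) (V : Finset (Wd (m+1))) : Finset (Wd m) :=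
  Finset.univ.filter (fun x => ins i l x ∈ V)

theorem mem_sl {m : ℕ} {i : Fin (m+1)} {l : Fin 4} {V : Finset (Wd (m+1))} {x : Wd m} :
    x ∈ sl i l V ↔ ins i l x ∈ V := by simp [sl]

theorem ins_rem {m : ℕ} (i : Fin (m+1)) (v : Wd (m+1)) :
    ins i (v i) (fun k => v (i.succAbove k)) = v := by
  rw [Fin.insertNth_eq_iff]; exact ⟨rfl, rfl⟩

theorem ins_inj {m : ℕ} {i : Fin (m+1)} {l l' : Fin 4} {x y : Wd m} :
    ins i l x = ins i l' y ↔ l = l' ∧ x = y := by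
  constructor
  · intro h
    constructor
    · simpa using congrFun h i
    · funext k
      simpa using congrFun h (i.succAbove k)
  · rintro ⟨rfl, rfl⟩; rfl

theorem rem_mem_sl {m : ℕ} {i : Fin (m+1)} {V : Finset (Wd (m+1))} {v : Wd (m+1)} (hv : v ∈ V) :
    (fun k => v (i.succAbove k)) ∈ sl i (v i) V := by
  rw [mem_sl, ins_rem]; exact hv

theorem dich_ins {m : ℕ} {i : Fin (m+1)} {l l' : Fin 4} {x y : Wd m} :
    Dichotomous compl4 (ins i l x) (ins i l' y) ↔ l' = compl4 l ∨ Dichotomous compl4 x y := by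
  unfold Dichotomous
  rw [Fin.exists_iff_succAbove i]
  simp

theorem twin_ins {m : ℕ} {i : Fin (m+1)} {l l' : Fin 4} {x y : Wd m} :
    TwinPair compl4 (ins i l x) (ins i l' y) ↔
      (l' = compl4 l ∧ x = y) ∨ (l = l' ∧ TwinPair compl4 x y) := by
  constructor
  · rintro ⟨j, hj, h⟩
    rcases Fin.eq_self_or_eq_succAbove i j with rfl | ⟨k, rfl⟩
    · left
      refine ⟨by simpa using hj, ?_⟩
      funext k
      simpa using h (j.succAbove k) (Fin.succAbove_ne j k)
    · right
      refine ⟨by simpa using h i (Fin.succAbove_ne i k).symm, k, by simpa using hj, ?_⟩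
      intro n hn
      simpa using h (i.succAbove n) (fun hh => hn (Fin.succAbove_right_injective hh))
  · rintro (⟨rfl, rfl⟩ | ⟨rfl, k, hk, h⟩)
    · refine ⟨i, by simp, fun n hn => ?_⟩
      rcases Fin.eq_self_or_eq_succAbove i n with rfl | ⟨k, rfl⟩
      · exact absurd rfl hn
      · simp
    · refine ⟨i.succAbove k, by simpa using hk, fun n hn => ?_⟩
      rcases Fin.eq_self_or_eq_succAbove i n with rfl | ⟨k', rfl⟩
      · simp
      · have : k' ≠ k := fun hh => hn (by rw [hh])
        simpa using h k' this

theorem pt_ins {m : ℕ} {i : Fin (m+1)} {l s : Fin 4} {x t : Wd m} :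
    Pt (ins i l x) (ins i s t) ↔ Cr l s ∧ Pt x t := by
  unfold Pt
  rw [Fin.forall_iff_succAbove i]
  simp

theorem in_ins {m : ℕ} {i : Fin (m+1)} {p l s : Fin 4} {y x t : Wd m} :
    In (ins i p y) (ins i l x) (ins i s t) ↔ (p = l ∨ p = s) ∧ In y x t := by
  unfold In
  rw [Fin.forall_iff_succAbove i]
  simp

theorem sl_code {m : ℕ} {V : Finset (Wd (m+1))} (hV : PolyboxCode compl4 V) (i : Fin (m+1))
    (l : Fin 4) : PolyboxCode compl4 (sl i l V) := by
  intro u hu v hv huv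
  have := hV _ (mem_sl.1 hu) _ (mem_sl.1 hv) (fun h => huv (ins_inj.1 h).2)
  rw [dich_ins] at this
  exact this.resolve_left (fun h => cne _ h.symm)

theorem sl2_dich {m : ℕ} {V : Finset (Wd (m+1))} (hV : PolyboxCode compl4 V) {i : Fin (m+1)}
    {l s : Fin 4} (h : Cr l s) {x y : Wd m} (hx : x ∈ sl i l V) (hy : y ∈ sl i s V) :
    Dichotomous compl4 x y := by
  have := hV _ (mem_sl.1 hx) _ (mem_sl.1 hy) (fun h' => h.1 (ins_inj.1 h').1.symm)
  rw [dich_ins] at this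
  exact this.resolve_left h.2

theorem sl2_code {m : ℕ} {V : Finset (Wd (m+1))} (hV : PolyboxCode compl4 V) (i : Fin (m+1))
    {l s : Fin 4} (h : Cr l s) : PolyboxCode compl4 (sl i l V ∪ sl i s V) := by
  intro u hu v hv huv
  rcases Finset.mem_union.1 hu with hu | hu <;> rcases Finset.mem_union.1 hv with hv | hv
  · exact sl_code hV i l u hu v hv huv
  · exact sl2_dich hV h hu hv
  · exact dich_symm (sl2_dich hV h hv hu)
  · exact sl_code hV i s u hu v hv huv

theorem sl_tf {m : ℕ} {V : Finset (Wd (m+1))} (hV : TwinPairFree compl4 V) (i : Fin (m+1))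
    (l : Fin 4) : TwinPairFree compl4 (sl i l V) := by
  intro u hu v hv huv
  exact hV _ (mem_sl.1 hu) _ (mem_sl.1 hv) (twin_ins.2 (Or.inr ⟨rfl, huv⟩))

theorem sl_opp {m : ℕ} {V : Finset (Wd (m+1))} (hV : TwinPairFree compl4 V) {i : Fin (m+1)}
    {l : Fin 4} {x : Wd m} (hx : x ∈ sl i l V) (hx' : x ∈ sl i (compl4 l) V) : False :=
  hV _ (mem_sl.1 hx) _ (mem_sl.1 hx') (twin_ins.2 (Or.inl ⟨rfl, rfl⟩))

theorem sl_eqv {m : ℕ} {V W : Finset (Wd (m+1))} (h : Eqv V W) (i : Fin (m+1))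
    {l s : Fin 4} (hls : Cr l s) : Eqv (sl i l V ∪ sl i s V) (sl i l W ∪ sl i s W) := by
  have key : ∀ (U : Finset (Wd (m+1))) (x t : Wd m), (∃ v ∈ sl i l U ∪ sl i s U, In v x t) ↔
      ∃ v ∈ U, In v (ins i l x) (ins i s t) := by
    intro U x t
    constructor
    · rintro ⟨v, hv, hi⟩
      rcases Finset.mem_union.1 hv with hv | hv
      · exact ⟨_, mem_sl.1 hv, in_ins.2 ⟨Or.inl rfl, hi⟩⟩
      · exact ⟨_, mem_sl.1 hv, in_ins.2 ⟨Or.inr rfl, hi⟩⟩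
    · rintro ⟨v, hv, hi⟩
      rw [← ins_rem i v, in_ins] at hi
      refine ⟨_, ?_, hi.2⟩
      rw [Finset.mem_union]
      rcases hi.1 with h | h
      · left; rw [← h]; exact rem_mem_sl hv
      · right; rw [← h]; exact rem_mem_sl hv
  intro x t hp
  rw [key, key]
  exact h _ _ (pt_ins.2 ⟨hls, hp⟩)

theorem sl_card {m : ℕ} (V : Finset (Wd (m+1))) (i : Fin (m+1)) (l : Fin 4) :
    (sl i l V).card = (V.filter (fun v => v i = l)).card := by
  apply Finset.card_bij (fun x _ => ins i l x)
  · intro x hx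
    rw [Finset.mem_filter]
    exact ⟨mem_sl.1 hx, by simp⟩
  · intro x _ y _ h
    exact (ins_inj.1 h).2
  · intro v hv
    rw [Finset.mem_filter] at hv
    refine ⟨_, hv.2 ▸ rem_mem_sl hv.1, ?_⟩
    rw [← hv.2]; exact ins_rem i v

theorem sl_disj {m : ℕ} {V : Finset (Wd (m+1))} (hV : PolyboxCode compl4 V) {i : Fin (m+1)}
    {l s : Fin 4} (h : Cr l s) : Disjoint (sl i l V) (sl i s V) := by
  rw [Finset.disjoint_left]
  intro x hx hy
  exact dich_irrefl (sl2_dich hV h hx hy)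

theorem card_split {m : ℕ} (V : Finset (Wd (m+1))) (i : Fin (m+1)) {l s : Fin 4} (h : Cr l s) :
    V.card = (sl i l V).card + (sl i s V).card + (sl i (compl4 l) V).card +
      (sl i (compl4 s) V).card := by
  have h1 : V.card = ∑ a : Fin 4, (sl i a V).card := by
    simp_rw [sl_card]
    exact Finset.card_eq_sum_card_fiberwise (fun _ _ => Finset.mem_coe.2 (Finset.mem_univ _))
  rw [h1, Fin.sum_univ_four]
  revert h
  generalize hf : (fun a => (sl i a V).card) = f
  have e : ∀ a, (sl i a V).card = f a := fun a => by rw [← hf]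
  simp only [e]
  intro h
  have : ∀ l s : Fin 4, Cr l s → (l = 0 ∧ s = 2) ∨ (l = 0 ∧ s = 3) ∨ (l = 1 ∧ s = 2) ∨
    (l = 1 ∧ s = 3) ∨ (l = 2 ∧ s = 0) ∨ (l = 2 ∧ s = 1) ∨ (l = 3 ∧ s = 0) ∨ (l = 3 ∧ s = 1) := by
    decide
  rcases this l s h with ⟨rfl, rfl⟩ | ⟨rfl, rfl⟩ | ⟨rfl, rfl⟩ | ⟨rfl, rfl⟩ | ⟨rfl, rfl⟩ | ⟨rfl, rfl⟩ | ⟨rfl, rfl⟩ | ⟨rfl, rfl⟩ <;> simp [compl4] <;> omega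

/-- `sl2` is twin free when no siblings. -/
def Sib {m : ℕ} (V : Finset (Wd m)) (i : Fin m) (l s : Fin 4) : Prop :=
  ∃ v ∈ V, ∃ u ∈ V, v i = l ∧ u i = s ∧ ∃ j, j ≠ i ∧ u j = compl4 (v j) ∧
    ∀ k, k ≠ i → k ≠ j → v k = u k

theorem sl2_tf {m : ℕ} {V : Finset (Wd (m+1))} (hV : TwinPairFree compl4 V) {i : Fin (m+1)}
    {l s : Fin 4} (h : ¬ Sib V i l s) : TwinPairFree compl4 (sl i l V ∪ sl i s V) := by
  have key : ∀ x ∈ sl i l V, ∀ y ∈ sl i s V, ¬ TwinPair compl4 x y := by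
    rintro x hx y hy ⟨j, hj, hk⟩
    refine h ⟨_, mem_sl.1 hx, _, mem_sl.1 hy, by simp, by simp, i.succAbove j,
      Fin.succAbove_ne i j, by simpa using hj, fun k hki hkj => ?_⟩
    rcases Fin.eq_self_or_eq_succAbove i k with rfl | ⟨k, rfl⟩
    · exact absurd rfl hki
    · simpa using hk k (fun hh => hkj (by rw [hh]))
  intro u hu v hv huv
  rcases Finset.mem_union.1 hu with hu | hu <;> rcases Finset.mem_union.1 hv with hv | hv
  · exact sl_tf hV i l u hu v hv huv
  · exact key _ hu _ hv huv
  · exact key _ hv _ hu (twin_symm huv)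
  · exact sl_tf hV i s u hu v hv huv

def mt {m : ℕ} (C : Finset (Wd m)) (x : Wd m) : Finset (Wd m) :=
  C.filter (fun c => ∀ j, c j ≠ compl4 (x j))

theorem mt_sub {m : ℕ} (C : Finset (Wd m)) (x : Wd m) : mt C x ⊆ C := Finset.filter_subset _ _

theorem in_mt {m : ℕ} {C : Finset (Wd m)} {c x t : Wd m} (hc : c ∈ C) (hp : Pt x t)
    (h : In c x t) : c ∈ mt C x := by
  refine Finset.mem_filter.2 ⟨hc, fun j => ?_⟩
  have h1 := hp j
  rcases h j with h2 | h2 <;> rw [h2]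
  · exact (cne _).symm
  · exact h1.2

theorem mt_cov {m : ℕ} {C : Finset (Wd m)} {x : Wd m} (h : CovW C x) : CovW (mt C x) x := by
  intro t ht
  obtain ⟨c, hc, hi⟩ := h t ht
  exact ⟨c, in_mt hc ht hi, hi⟩

def fx {m : ℕ} (x c : Wd m) : Finset (Fin m) := Finset.univ.filter (fun j => c j ≠ x j)

theorem mem_fx {m : ℕ} {x c : Wd m} {j : Fin m} : j ∈ fx x c ↔ c j ≠ x j := by simp [fx]

/-- extension of `c` to a transversal of `x` -/
theorem ext_t {m : ℕ} {x c : Wd m} (h : ∀ j, c j ≠ compl4 (x j)) :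
    ∃ t, Pt x t ∧ ∀ j, c j ≠ x j → t j = c j := by
  have : ∀ j, ∃ q, Cr (x j) q ∧ (c j ≠ x j → q = c j) := by
    intro j
    by_cases hj : c j = x j
    · obtain ⟨q, hq⟩ := exCr (x j)
      exact ⟨q, hq, fun h' => absurd hj h'⟩
    · exact ⟨c j, ⟨hj, h j⟩, fun _ => rfl⟩
  choose t ht using this
  exact ⟨t, fun j => (ht j).1, fun j => (ht j).2⟩

def flip {m : ℕ} (t : Wd m) (D : Finset (Fin m)) : Wd m :=
  fun j => if j ∈ D then compl4 (t j) else t j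

theorem flip_pt {m : ℕ} {x t : Wd m} (h : Pt x t) (D : Finset (Fin m)) : Pt x (flip t D) := by
  intro j
  unfold flip
  split_ifs
  · exact (h j).compl
  · exact h j

/-- cells at two flips can only be dichotomous inside the flipped sets -/
theorem flip_dich {m : ℕ} {x t : Wd m} (h : Pt x t) {D E : Finset (Fin m)} {d e : Wd m}
    (hd : In d x (flip t D)) (he : In e x (flip t E)) {k : Fin m} (hk : e k = compl4 (d k)) :
    d k ≠ x k ∧ e k ≠ x k ∧ ((k ∈ D ∧ k ∉ E) ∨ (k ∉ D ∧ k ∈ E)) := by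
  have h1 := h k
  have h2 := hd k
  have h3 := he k
  unfold flip at h2 h3
  have k1 : ∀ a b p q : Fin 4, Cr p q → b = compl4 a →
    (a = p ∨ a = q) → (b = p ∨ b = q) → False := by decide
  have k2 : ∀ a b p q : Fin 4, Cr p q → b = compl4 a →
    (a = p ∨ a = q) → (b = p ∨ b = compl4 q) → a ≠ p ∧ b ≠ p := by decide
  have k3 : ∀ a b p q : Fin 4, Cr p q → b = compl4 a →
    (a = p ∨ a = compl4 q) → (b = p ∨ b = q) → a ≠ p ∧ b ≠ p := by decide
  split_ifs at h2 h3 with a b b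
  · exact absurd (k1 _ _ _ _ h1.compl hk h2 h3) id
  · have := k3 _ _ _ _ h1 hk h2 h3
    tauto
  · have := k2 _ _ _ _ h1 hk h2 h3
    tauto
  · exact absurd (k1 _ _ _ _ h1 hk h2 h3) id

theorem max_cell {m : ℕ} {C : Finset (Wd m)} {x : Wd m} (h : CovW C x) :
    ∃ c ∈ mt C x, ∀ d ∈ mt C x, (fx x d).card ≤ (fx x c).card := by
  apply Finset.exists_max_image
  have : ∃ t, Pt x t := by
    choose t ht using fun j => exCr (x j)
    exact ⟨t, ht⟩
  obtain ⟨t, ht⟩ := this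
  obtain ⟨c, hc, _⟩ := mt_cov h t ht
  exact ⟨c, hc⟩

theorem twin_of {m : ℕ} {c d : Wd m} {x : Wd m} (hs : fx x c ⊆ fx x d)
    (hcard : (fx x d).card ≤ (fx x c).card) {p : Fin m} (hp : d p = compl4 (c p))
    (h : ∀ k ∈ fx x c, k ≠ p → d k = c k) : TwinPair compl4 c d := by
  have heq := Finset.eq_of_subset_of_card_le hs hcard
  refine ⟨p, hp, fun k hk => ?_⟩
  by_cases hk' : k ∈ fx x c
  · exact (h k hk' hk).symm
  · have h2 := hk'
    rw [heq] at h2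
    rw [mem_fx, not_not] at hk' h2
    rw [hk', h2]

theorem cell_flip {m : ℕ} {C : Finset (Wd m)} (hC : PolyboxCode compl4 C) {x c t d : Wd m}
    (hc : c ∈ C) (hd : d ∈ C) (hp : Pt x t) (ht : ∀ j, c j ≠ x j → t j = c j) {p : Fin m}
    (hpf : c p ≠ x p) (hi : In d x (flip t {p})) : d p = compl4 (c p) ∧
      ∀ k, k ≠ p → d k = x k ∨ d k = t k := by
  have hic : In c x (flip t ∅) := by
    intro j
    by_cases hj : c j = x j
    · exact Or.inl hj
    · right; simp [flip, ht j hj]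
  have hne : c ≠ d := by
    rintro rfl
    have h1 := hi p
    simp only [flip, Finset.mem_singleton, if_true, ht p hpf] at h1
    rcases h1 with h1 | h1
    · exact hpf h1
    · exact cne _ h1.symm
  obtain ⟨k, hk⟩ := hC c hc d hd hne
  have := flip_dich hp hic hi hk
  have hkp : k = p := by simpa using this.2.2
  subst hkp
  refine ⟨hk, fun k hk => ?_⟩
  have := hi k
  simpa [flip, hk] using this

theorem lemma3 {m : ℕ} {C : Finset (Wd m)} (hC : PolyboxCode compl4 C)
    (hT : TwinPairFree compl4 C) {x : Wd m} (h : CovW C x) (hx : x ∉ C) :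
    ∃ c ∈ mt C x, (∀ d ∈ mt C x, (fx x d).card ≤ (fx x c).card) ∧ 3 ≤ (fx x c).card := by
  obtain ⟨c, hc, hmax⟩ := max_cell h
  refine ⟨c, hc, hmax, ?_⟩
  by_contra hlt
  push Not at hlt
  have hcC := mt_sub _ _ hc
  obtain ⟨t, hp, ht⟩ := ext_t (Finset.mem_filter.1 hc).2
  have hcell := fun D => h (flip t D) (flip_pt hp D)
  interval_cases hn : (fx x c).card
  · rw [Finset.card_eq_zero] at hn
    apply hx
    convert hcC
    funext j
    by_contra hj
    have : j ∈ fx x c := mem_fx.2 (Ne.symm hj)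
    simp [hn] at this
  · obtain ⟨p, hf⟩ := Finset.card_eq_one.1 hn
    obtain ⟨d, hd, hi⟩ := hcell {p}
    have hpf : c p ≠ x p := mem_fx.1 (by simp [hf])
    have h1 := cell_flip hC hcC hd hp ht hpf hi
    refine hT c hcC d hd (twin_of (x := x) (p := p) ?_ ?_ h1.1 ?_)
    · rw [hf, Finset.singleton_subset_iff, mem_fx, h1.1]
      have h2 := hp p
      rw [ht p hpf] at h2
      exact h2.compl.1
    · rw [hn]; exact hmax d (in_mt hd (flip_pt hp _) hi)
    · intro k hk hkp
      rw [hf] at hk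
      simp at hk
      exact absurd hk hkp
  · obtain ⟨p, q, hpq, hf⟩ := Finset.card_eq_two.1 hn
    have hpf : c p ≠ x p := mem_fx.1 (by simp [hf])
    have hqf : c q ≠ x q := mem_fx.1 (by simp [hf])
    obtain ⟨d, hd, hi⟩ := hcell {p}
    obtain ⟨e, he, hj⟩ := hcell {q}
    have h1 := cell_flip hC hcC hd hp ht hpf hi
    have h2 := cell_flip hC hcC he hp ht hqf hj
    have cp := hp p
    rw [ht p hpf] at cp
    have cq := hp q
    rw [ht q hqf] at cq
    have hdq : d q = x q := by
      rcases h1.2 q hpq.symm with h' | h'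
      · exact h'
      · exfalso
        rw [ht q hqf] at h'
        refine hT c hcC d hd (twin_of (x := x) (p := p) ?_ ?_ h1.1 ?_)
        · rw [hf]
          intro k hk
          simp only [Finset.mem_insert, Finset.mem_singleton] at hk
          rw [mem_fx]
          rcases hk with rfl | rfl
          · rw [h1.1]; exact cp.compl.1
          · rw [h']; exact hqf
        · rw [hn]; exact hmax d (in_mt hd (flip_pt hp _) hi)
        · intro k hk hkp
          rw [hf] at hk
          simp only [Finset.mem_insert, Finset.mem_singleton] at hk
          rcases hk with rfl | rfl
          · exact absurd rfl hkp
          · exact h'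
    have hep : e p = x p := by
      rcases h2.2 p hpq with h' | h'
      · exact h'
      · exfalso
        rw [ht p hpf] at h'
        refine hT c hcC e he (twin_of (x := x) (p := q) ?_ ?_ h2.1 ?_)
        · rw [hf]
          intro k hk
          simp only [Finset.mem_insert, Finset.mem_singleton] at hk
          rw [mem_fx]
          rcases hk with rfl | rfl
          · rw [h']; exact hpf
          · rw [h2.1]; exact cq.compl.1
        · rw [hn]; exact hmax e (in_mt he (flip_pt hp _) hj)
        · intro k hk hkp
          rw [hf] at hk
          simp only [Finset.mem_insert, Finset.mem_singleton] at hk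
          rcases hk with rfl | rfl
          · exact h'
          · exact absurd rfl hkp
    have hne : d ≠ e := by
      rintro rfl
      exact cp.compl.1 (h1.1 ▸ hep)
    obtain ⟨k, hk⟩ := hC d hd e he hne
    have h3 := flip_dich hp hi hj hk
    have : k = p ∨ k = q := by
      have := h3.2.2
      simp only [Finset.mem_singleton] at this
      tauto
    rcases this with rfl | rfl
    · exact h3.2.1 hep
    · exact h3.1 hdq

theorem lemma5_aux {m : ℕ} {C : Finset (Wd m)} (hC : PolyboxCode compl4 C)
    (hT : TwinPairFree compl4 C) {x c t : Wd m} (hc : c ∈ C) (hp : Pt x t)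
    (ht : ∀ j, c j ≠ x j → t j = c j)
    (hmax : ∀ d ∈ mt C x, (fx x d).card ≤ (fx x c).card)
    {p q r : Fin m} (hpq : p ≠ q) (hpr : p ≠ r) (hqr : q ≠ r) (hf : fx x c = {p, q, r})
    {d1 d2 d3 : Wd m} (h1 : d1 ∈ C) (h2 : d2 ∈ C) (h3 : d3 ∈ C)
    (i1 : In d1 x (flip t {p})) (i2 : In d2 x (flip t {q})) (i3 : In d3 x (flip t {r}))
    (ic : In d1 x (flip t {p, q, r})) : False := by
  have hpf : c p ≠ x p := mem_fx.1 (by simp [hf])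
  have hqf : c q ≠ x q := mem_fx.1 (by simp [hf])
  have hrf : c r ≠ x r := mem_fx.1 (by simp [hf])
  have cp := hp p
  rw [ht p hpf] at cp
  have cq := hp q
  rw [ht q hqf] at cq
  have cr := hp r
  rw [ht r hrf] at cr
  have e1 := cell_flip hC hc h1 hp ht hpf i1
  have e2 := cell_flip hC hc h2 hp ht hqf i2
  have e3 := cell_flip hC hc h3 hp ht hrf i3
  have hd1q : d1 q = x q := by
    have a := e1.2 q hpq.symm
    have b := ic q
    simp only [flip, Finset.mem_insert, Finset.mem_singleton, true_or, or_true, if_true] at b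
    rcases a with a | a
    · exact a
    · rcases b with b | b
      · exact b
      · exact absurd (b.symm.trans a) (cne _)
  have hd1r : d1 r = x r := by
    have a := e1.2 r hpr.symm
    have b := ic r
    simp only [flip, Finset.mem_insert, Finset.mem_singleton, or_true, if_true] at b
    rcases a with a | a
    · exact a
    · rcases b with b | b
      · exact b
      · exact absurd (b.symm.trans a) (cne _)
  have hd2p : d2 p = c p := by
    have hne : d1 ≠ d2 := by
      rintro rfl
      rw [e2.1] at hd1q
      exact cq.compl.1 hd1q
    obtain ⟨k, hk⟩ := hC d1 h1 d2 h2 hne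
    have h4 := flip_dich hp i1 i2 hk
    have : k = p ∨ k = q := by
      have := h4.2.2
      simp only [Finset.mem_singleton] at this
      tauto
    rcases this with rfl | rfl
    · rw [hk, e1.1, cc]
    · exact absurd hd1q h4.1
  have hd3p : d3 p = c p := by
    have hne : d1 ≠ d3 := by
      rintro rfl
      rw [e3.1] at hd1r
      exact cr.compl.1 hd1r
    obtain ⟨k, hk⟩ := hC d1 h1 d3 h3 hne
    have h4 := flip_dich hp i1 i3 hk
    have : k = p ∨ k = r := by
      have := h4.2.2
      simp only [Finset.mem_singleton] at this
      tauto
    rcases this with rfl | rfl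
    · rw [hk, e1.1, cc]
    · exact absurd hd1r h4.1
  have hne : d2 ≠ d3 := by
    rintro rfl
    rcases e2.2 r hqr.symm with h | h
    · rw [e3.1] at h; exact cr.compl.1 h
    · rw [e3.1, ht r hrf] at h; exact cne _ h
  obtain ⟨k, hk⟩ := hC d2 h2 d3 h3 hne
  have h4 := flip_dich hp i2 i3 hk
  have : k = q ∨ k = r := by
    have := h4.2.2
    simp only [Finset.mem_singleton] at this
    tauto
  rcases this with rfl | rfl
  · have hd3q : d3 k = c k := by rw [hk, e2.1, cc]
    refine hT c hc d3 h3 (twin_of (x := x) (p := r) ?_ (hmax d3 (in_mt h3 (flip_pt hp _) i3)) e3.1 ?_)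
    · rw [hf]
      intro j hj
      simp only [Finset.mem_insert, Finset.mem_singleton] at hj
      rw [mem_fx]
      rcases hj with rfl | rfl | rfl
      · rw [hd3p]; exact hpf
      · rw [hd3q]; exact hqf
      · rw [e3.1]; exact cr.compl.1
    · rw [hf]
      intro j hj hjr
      simp only [Finset.mem_insert, Finset.mem_singleton] at hj
      rcases hj with rfl | rfl | rfl
      · exact hd3p
      · exact hd3q
      · exact absurd rfl hjr
  · have hd2r : d2 k = c k := by rw [e3.1] at hk; exact (cinj hk).symm
    refine hT c hc d2 h2 (twin_of (x := x) (p := q) ?_ (hmax d2 (in_mt h2 (flip_pt hp _) i2)) e2.1 ?_)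
    · rw [hf]
      intro j hj
      simp only [Finset.mem_insert, Finset.mem_singleton] at hj
      rw [mem_fx]
      rcases hj with rfl | rfl | rfl
      · rw [hd2p]; exact hpf
      · rw [e2.1]; exact cq.compl.1
      · rw [hd2r]; exact hrf
    · rw [hf]
      intro j hj hjr
      simp only [Finset.mem_insert, Finset.mem_singleton] at hj
      rcases hj with rfl | rfl | rfl
      · exact hd2p
      · exact absurd rfl hjr
      · exact hd2r

theorem lemma5' {m : ℕ} {C : Finset (Wd m)} (hC : PolyboxCode compl4 C)
    (hT : TwinPairFree compl4 C) {x : Wd m} (h : CovW C x) (hx : x ∉ C) : 5 ≤ C.card := by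
  obtain ⟨c, hcm, hmax, h3⟩ := lemma3 hC hT h hx
  have hc := mt_sub _ _ hcm
  obtain ⟨t, hp, ht⟩ := ext_t (Finset.mem_filter.1 hcm).2
  have hcell := fun D => h (flip t D) (flip_pt hp D)
  choose F hF hI using hcell
  have e := fun p (hp' : p ∈ fx x c) => cell_flip hC hc (hF {p}) hp ht (mem_fx.1 hp') (hI {p})
  have hxt : ∀ p ∈ fx x c, Cr (x p) (c p) := fun p h' => by
    have := hp p
    rwa [ht p (mem_fx.1 h')] at this
  have hinj : Set.InjOn (fun p => F {p}) (fx x c : Set (Fin m)) := by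
    intro p hp' q hq hpq
    by_contra hne
    simp only at hpq
    have h1 := (e p hp').1
    have h2 := (e q hq).2 p hne
    rw [← hpq, h1] at h2
    rcases h2 with h2 | h2
    · exact (hxt p hp').compl.1 h2
    · rw [ht p (mem_fx.1 hp')] at h2; exact cne _ h2
  have hcn : c ∉ (fx x c).image (fun p => F {p}) := by
    rw [Finset.mem_image]
    rintro ⟨p, hp', h'⟩
    have := (e p hp').1
    rw [h'] at this
    exact cne _ this.symm
  have hsub : insert c ((fx x c).image (fun p => F {p})) ⊆ C := by
    intro y hy
    rw [Finset.mem_insert, Finset.mem_image] at hy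
    rcases hy with rfl | ⟨p, _, rfl⟩
    · exact hc
    · exact hF _
  have hcard : (insert c ((fx x c).image (fun p => F {p}))).card = (fx x c).card + 1 := by
    rw [Finset.card_insert_of_notMem hcn, Finset.card_image_of_injOn hinj]
  have hle := Finset.card_le_card hsub
  by_contra hlt
  have h3' : (fx x c).card = 3 := by omega
  have heq := Finset.eq_of_subset_of_card_le hsub (by omega)
  obtain ⟨p, q, r, hpq, hpr, hqr, hf⟩ := Finset.card_eq_three.1 h3'
  have hm := hF {p, q, r}
  have hi := hI {p, q, r}
  rw [← heq, Finset.mem_insert, hf, Finset.mem_image] at hm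
  rcases hm with hm | ⟨y, hy, hm⟩
  · rw [hm] at hi
    have := hi p
    have hpf : p ∈ fx x c := by simp [hf]
    simp only [flip, Finset.mem_insert, true_or, if_true, ht p (mem_fx.1 hpf)] at this
    rcases this with this | this
    · exact mem_fx.1 hpf this
    · exact cne _ this.symm
  · simp only [Finset.mem_insert, Finset.mem_singleton] at hy
    rw [← hm] at hi
    rcases hy with rfl | rfl | rfl
    · exact lemma5_aux hC hT hc hp ht hmax hpq hpr hqr hf (hF {y}) (hF {q}) (hF {r})
        (hI _) (hI _) (hI _) hi
    · have e1 : ({p, y, r} : Finset (Fin m)) = {y, p, r} := by ext; simp; tauto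
      rw [e1] at hi hf
      exact lemma5_aux hC hT hc hp ht hmax hpq.symm hqr hpr hf (hF {y}) (hF {p}) (hF {r})
        (hI _) (hI _) (hI _) hi
    · have e1 : ({p, q, y} : Finset (Fin m)) = {y, p, q} := by ext; simp; tauto
      rw [e1] at hi hf
      exact lemma5_aux hC hT hc hp ht hmax hpr.symm hqr.symm hpq hf (hF {y}) (hF {p}) (hF {q})
        (hI _) (hI _) (hI _) hi

theorem lemma5 {m : ℕ} {C : Finset (Wd m)} (hC : PolyboxCode compl4 C)
    (hT : TwinPairFree compl4 C) {x : Wd m} (h : CovW C x) (hx : x ∉ C) : 5 ≤ (mt C x).card :=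
  lemma5' (code_mono (mt_sub _ _) hC) (tf_mono (mt_sub _ _) hT) (mt_cov h)
    (fun h' => hx (mt_sub _ _ h'))

theorem cov_opp {m : ℕ} {V P : Finset (Wd (m+1))} (hV : PolyboxCode compl4 V) (h : Eqv V P)
    {i : Fin (m+1)} {a b : Fin 4} (hab : Cr a b) {x : Wd m} (hx : x ∈ sl i a V)
    (hx' : x ∈ sl i b P) : CovW (sl i (compl4 a) V) x := by
  intro t ht
  obtain ⟨c, hc, hi⟩ := (sl_eqv h i hab.compl_left).cov (Finset.mem_union_right _ hx') t ht
  rcases Finset.mem_union.1 hc with hc | hc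
  · exact ⟨c, hc, hi⟩
  · exact absurd (sl2_dich hV hab hx hc) (in_not_dich ht (in_self x t) hi)

def TProp (m : ℕ) : Prop := ∀ V P : Finset (Wd m), PolyboxCode compl4 V → TwinPairFree compl4 V →
  PolyboxCode compl4 P → Eqv V P → V.card ≤ 10 → V = P

theorem sl_union_card {m : ℕ} {V : Finset (Wd (m+1))} (hV : PolyboxCode compl4 V) {i : Fin (m+1)}
    {l s : Fin 4} (h : Cr l s) :
    (sl i l V ∪ sl i s V).card = (sl i l V).card + (sl i s V).card :=
  Finset.card_union_of_disjoint (sl_disj hV h)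

theorem swap_slices {m : ℕ} (T : TProp m) {V P : Finset (Wd (m+1))} (hV : PolyboxCode compl4 V)
    (hVt : TwinPairFree compl4 V) (hP : PolyboxCode compl4 P) (h : Eqv V P) (hd : Disjoint V P)
    {i : Fin (m+1)} {a b : Fin 4} (hab : Cr a b) (hs : ¬ Sib V i a b)
    (hc : (sl i a V).card + (sl i b V).card ≤ 10) :
    sl i a V = sl i b P ∧ sl i b V = sl i a P := by
  have hu := T _ _ (sl2_code hV i hab) (sl2_tf hVt hs) (sl2_code hP i hab) (sl_eqv h i hab)
    (by rw [sl_union_card hV hab]; exact hc)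
  have dj : ∀ l x, x ∈ sl i l V → x ∉ sl i l P := fun l x h1 h2 =>
    Finset.disjoint_left.1 hd (mem_sl.1 h1) (mem_sl.1 h2)
  have key : ∀ x, (x ∈ sl i a V ∨ x ∈ sl i b V) ↔ (x ∈ sl i a P ∨ x ∈ sl i b P) := fun x => by
    rw [← Finset.mem_union, hu, Finset.mem_union]
  constructor <;> ext x <;> have h1 := key x <;> have h2 := dj a x <;> have h3 := dj b x <;> tauto

theorem T_step {m : ℕ} (T : TProp m)
    (core : ∀ V : Finset (Wd (m+1)), PolyboxCode compl4 V → TwinPairFree compl4 V →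
      V.card ≤ 10 → (∀ i l s, Cr l s → Sib V i l s) → False) : TProp (m+1) := by
  have main : ∀ V P : Finset (Wd (m+1)), PolyboxCode compl4 V → TwinPairFree compl4 V →
      PolyboxCode compl4 P → Eqv V P → Disjoint V P → V.card ≤ 10 → V = ∅ := by
    intro V P hV hVt hP h hd hc
    by_contra hne
    apply core V hV hVt hc
    intro i a b hab
    by_contra hs
    have hsp := card_split V i hab
    obtain ⟨e1, e2⟩ := swap_slices T hV hVt hP h hd hab hs (by omega)
    have dj : ∀ l x, x ∈ sl i l V → x ∉ sl i l P := fun l x h1 h2 =>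
      Finset.disjoint_left.1 hd (mem_sl.1 h1) (mem_sl.1 h2)
    -- one-sided case
    have one : ∀ a b, Cr a b → sl i a V = sl i b P → sl i b V = ∅ → sl i a V = ∅ ∧
        sl i (compl4 a) V = sl i (compl4 a) P ∪ sl i b P := by
      intro a b hab e1 e2
      have hsp := card_split V i hab
      have h2 := sl_eqv h i hab.compl_left
      rw [e2, Finset.union_empty] at h2
      have h3 := T _ _ (sl_code hV i _) (sl_tf hVt i _) (sl2_code hP i hab.compl_left) h2 (by omega)
      refine ⟨?_, h3⟩
      rw [Finset.eq_empty_iff_forall_notMem]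
      intro x hx
      refine sl_opp hVt hx ?_
      rw [h3, Finset.mem_union, ← e1]
      exact Or.inr hx
    by_cases ha : sl i a V = ∅
    · have hb : sl i b V = ∅ := (one b a hab.symm e2 ha).1
      have fa : sl i (compl4 a) V = ∅ := by
        have h2 := (one a b hab e1 hb).2
        rw [Finset.eq_empty_iff_forall_notMem]
        intro x hx
        have hx' := hx
        rw [h2, ← e1, ha, Finset.union_empty] at hx'
        exact dj _ _ hx hx'
      have fb : sl i (compl4 b) V = ∅ := by
        have h2 := (one b a hab.symm e2 ha).2
        rw [Finset.eq_empty_iff_forall_notMem]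
        intro x hx
        have hx' := hx
        rw [h2, ← e2, hb, Finset.union_empty] at hx'
        exact dj _ _ hx hx'
      apply hne
      rw [← Finset.card_eq_zero, hsp, ha, hb, fa, fb]
      simp
    · by_cases hb : sl i b V = ∅
      · exact ha (one a b hab e1 hb).1
      · obtain ⟨x, hx⟩ := Finset.nonempty_iff_ne_empty.2 ha
        obtain ⟨y, hy⟩ := Finset.nonempty_iff_ne_empty.2 hb
        have c1 := lemma5' (sl_code hV i _) (sl_tf hVt i _) (cov_opp hV h hab hx (e1 ▸ hx))
          (fun h' => sl_opp hVt hx h')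
        have c2 := lemma5' (sl_code hV i _) (sl_tf hVt i _) (cov_opp hV h hab.symm hy (e2 ▸ hy))
          (fun h' => sl_opp hVt hy h')
        have c3 := Finset.card_pos.2 ⟨x, hx⟩
        have c4 := Finset.card_pos.2 ⟨y, hy⟩
        omega
  intro V P hV hVt hP h hc
  have h1 : V \ P = ∅ := main _ (P \ V) (code_mono Finset.sdiff_subset hV)
    (tf_mono Finset.sdiff_subset hVt) (code_mono Finset.sdiff_subset hP) (Eqv_sdiff hV hP h)
    (disjoint_sdiff_sdiff) ((Finset.card_le_card Finset.sdiff_subset).trans hc)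
  have h2 : P \ V = ∅ := by
    rw [Finset.eq_empty_iff_forall_notMem]
    intro x hx
    have := (Eqv_sdiff hV hP h).cov hx
    choose t ht using fun j => exCr (x j)
    obtain ⟨c, hc, _⟩ := this t ht
    simp [h1] at hc
  exact Finset.Subset.antisymm (Finset.sdiff_eq_empty_iff_subset.1 h1)
    (Finset.sdiff_eq_empty_iff_subset.1 h2)

theorem T_zero : TProp 0 := by
  intro V P _ _ _ h _
  have := h (fun _ => 0) (fun _ => 0) (fun j => j.elim0)
  ext x
  have hx : ∀ y : Wd 0, y = x := fun y => Subsingleton.elim _ _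
  constructor
  · intro hx'
    obtain ⟨w, hw, _⟩ := this.1 ⟨x, hx', fun j => j.elim0⟩
    rwa [hx w] at hw
  · intro hx'
    obtain ⟨w, hw, _⟩ := this.2 ⟨x, hx', fun j => j.elim0⟩
    rwa [hx w] at hw
def tb (m n : ℕ) : Bool := Nat.beq (Nat.land (Nat.shiftRight m n) 1) 1
def okM : ℕ := 15806455052149901988896086440507477191184006912074854443498244333460948656865
def nbM : ℕ := 411489127161538470814798210135282940361829711311049837324804800
def okN (u v : ℕ) : Bool := tb okM (Nat.xor u v)
def nbN (u v : ℕ) : Bool := tb nbM (Nat.xor u v)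
def dg (i l u : ℕ) : Bool := Nat.beq (Nat.land (Nat.shiftRight u i) 3) l

noncomputable def cnd (b t e : Bool) : Bool := Bool.rec (motive := fun _ => Bool) e t b

noncomputable def filt (p : ℕ → Bool) (k : List ℕ → Bool) (L : List ℕ) : List ℕ → Bool :=
  List.rec (motive := fun _ => List ℕ → Bool) (fun acc => k acc)
    (fun a _ ih acc => cnd (p a) (ih (a :: acc)) (ih acc)) L

noncomputable def allb (p : ℕ → Bool) (L : List ℕ) : Bool :=
  List.rec (motive := fun _ => Bool) true (fun a _ ih => cnd (p a) ih false) L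

noncomputable def memb (a : ℕ) (L : List ℕ) : Bool :=
  List.rec (motive := fun _ => Bool) false (fun b _ ih => cnd (Nat.beq a b) true ih) L

noncomputable def sat (i l s : ℕ) (C : List ℕ) : Bool :=
  cnd (allb (fun u => cnd (dg i l u) (allb (fun v => cnd (dg i s v) (cnd (nbN u v) false true) true) C) true) C) false true

/-- insert with bound -/
noncomputable def insK (u : ℕ) (C : List ℕ) (n : ℕ) (k : List ℕ → ℕ → Bool) : Bool :=
  cnd (memb u C) (k C n) (match n with
    | 0 => true
    | n+1 => k (u :: C) n)

noncomputable def srch : List (ℕ × ℕ × ℕ) → List ℕ → ℕ → List ℕ → Bool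
  | [], _, _, _ => false
  | (i, l, s) :: rs, C, n, AL => cnd (sat i l s C) (srch rs C n AL)
      (filt (dg i l) (fun L => filt (dg i s) (fun M => allb (fun u => allb (fun v =>
        cnd (nbN u v)
          (insK u C n fun C n => insK v C n fun C n =>
            filt (fun w => cnd (okN u w) (okN v w) false) (fun AL => srch rs C n AL) AL []) true)
        M) L) AL []) AL [])

def sibs : ℕ → List (ℕ × ℕ × ℕ)
  | 1 => [(0, 0, 2), (0, 0, 3), (0, 1, 2), (0, 1, 3), (0, 2, 0), (0, 2, 1), (0, 3, 0), (0, 3, 1)]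
  | 2 => [(0, 0, 2), (0, 0, 3), (0, 1, 2), (0, 1, 3), (0, 2, 0), (0, 2, 1), (0, 3, 0), (0, 3, 1), (2, 0, 2), (2, 0, 3), (2, 1, 2), (2, 1, 3), (2, 2, 0), (2, 2, 1), (2, 3, 0), (2, 3, 1)]
  | 3 => [(0, 0, 2), (0, 0, 3), (0, 1, 2), (0, 1, 3), (0, 2, 0), (0, 2, 1), (0, 3, 0), (0, 3, 1), (2, 0, 2), (2, 0, 3), (2, 1, 2), (2, 1, 3), (2, 2, 0), (2, 2, 1), (2, 3, 0), (2, 3, 1), (4, 0, 2), (4, 0, 3), (4, 1, 2), (4, 1, 3), (4, 2, 0), (4, 2, 1), (4, 3, 0), (4, 3, 1)]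
  | 4 => [(0, 0, 2), (0, 0, 3), (0, 1, 2), (0, 1, 3), (0, 2, 0), (0, 2, 1), (0, 3, 0), (0, 3, 1), (2, 0, 2), (2, 0, 3), (2, 1, 2), (2, 1, 3), (2, 2, 0), (2, 2, 1), (2, 3, 0), (2, 3, 1), (4, 0, 2), (4, 0, 3), (4, 1, 2), (4, 1, 3), (4, 2, 0), (4, 2, 1), (4, 3, 0), (4, 3, 1), (6, 0, 2), (6, 0, 3), (6, 1, 2), (6, 1, 3), (6, 2, 0), (6, 2, 1), (6, 3, 0), (6, 3, 1)]
  | _ => []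

def no3 (x : ℕ) : Bool := Nat.beq (Nat.land (Nat.land x (Nat.shiftRight x 1)) 85) 0
def hb (x : ℕ) : ℕ := Nat.land x 170

noncomputable def strs (k : List ℕ → Bool) (nbl : List ℕ) : ℕ → ℕ → List ℕ → Bool
  | 0, _, P => k P
  | n+1, j, P => allb (fun x => cnd (dg j 1 x)
      (cnd (cnd (no3 x) true (!(allb (fun y => !(Nat.beq (hb x) (hb y))) P)))
        (cnd (allb (okN x) P) (strs k nbl n (j+2) (x :: P)) true) true) true) nbl

noncomputable def start (rs : List (ℕ × ℕ × ℕ)) : List ℕ → List ℕ → ℕ → List ℕ → Bool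
  | [], C, n, AL => srch rs C n AL
  | x :: P, C, n, AL => insK x C n fun C n =>
      filt (okN x) (fun AL => start rs P C n AL) AL []

noncomputable def chk (m : ℕ) : Bool :=
  filt (okN 0) (fun AL => filt (nbN 0) (fun nbl =>
    strs (fun P => start (sibs m) P [0] 9 AL) nbl m 0 []) AL []) (List.range (4 ^ m)) []

set_option maxRecDepth 100000 in
theorem chk1 : chk 1 = true := by decide +kernel
set_option maxRecDepth 100000 in
theorem chk2 : chk 2 = true := by decide +kernel
set_option maxRecDepth 100000 in
theorem chk3 : chk 3 = true := by decide +kernel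

theorem cnd_true {b t e : Bool} : cnd b t e = true ↔ (b = true ∧ t = true) ∨ (b = false ∧ e = true) := by
  cases b <;> simp [cnd]

theorem cnd_imp {b t : Bool} (h : cnd b t true = true) (hb : b = true) : t = true := by
  subst hb; exact h

theorem filt_eq (p : ℕ → Bool) (k : List ℕ → Bool) : ∀ L acc,
    filt p k L acc = k ((L.filter p).reverse ++ acc) := by
  intro L
  induction L with
  | nil => intro acc; rfl
  | cons a t ih =>
    intro acc
    have : filt p k (a :: t) acc = cnd (p a) (filt p k t (a :: acc)) (filt p k t acc) := rfl
    rw [this, ih, ih]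
    cases h : p a <;> simp [cnd, h]

theorem filt_use {p : ℕ → Bool} {k : List ℕ → Bool} {L : List ℕ} (h : filt p k L [] = true) :
    ∃ M, (∀ x, x ∈ M ↔ x ∈ L ∧ p x = true) ∧ k M = true := by
  rw [filt_eq] at h
  exact ⟨_, fun x => by simp, h⟩

theorem allb_iff (p : ℕ → Bool) (L : List ℕ) : allb p L = true ↔ ∀ x ∈ L, p x = true := by
  induction L with
  | nil => simp [allb]
  | cons a t ih =>
    have : allb p (a :: t) = cnd (p a) (allb p t) false := rfl
    rw [this, cnd_true, ih]
    simp

theorem memb_iff (a : ℕ) (L : List ℕ) : memb a L = true ↔ a ∈ L := by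
  induction L with
  | nil => simp [memb]
  | cons b t ih =>
    have : memb a (b :: t) = cnd (Nat.beq a b) true (memb a t) := rfl
    rw [this, cnd_true, ih]
    simp only [List.mem_cons]
    cases h : Nat.beq a b
    · have := Nat.ne_of_beq_eq_false h
      simp [this]
    · have := Nat.eq_of_beq_eq_true h
      simp [this]

structure SInv (V : Finset ℕ) (C : List ℕ) (n : ℕ) (AL : List ℕ) : Prop where
  sub : ∀ x ∈ C, x ∈ V
  nd : C.Nodup
  len : C.length + n = 10
  al : ∀ x ∈ V, x ∈ AL

theorem insK_use {V : Finset ℕ} {C : List ℕ} {n : ℕ} {AL : List ℕ} (hV : V.card ≤ 10)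
    (I : SInv V C n AL) {u : ℕ} (hu : u ∈ V) {k : List ℕ → ℕ → Bool} (h : insK u C n k = true) :
    ∃ C' n', SInv V C' n' AL ∧ k C' n' = true := by
  unfold insK at h
  rw [cnd_true] at h
  rcases h with ⟨_, h⟩ | ⟨h1, h⟩
  · exact ⟨C, n, I, h⟩
  · have hm : u ∉ C := by
      intro hm
      rw [← memb_iff, h1] at hm
      exact absurd hm (by decide)
    have hnd : (u :: C).Nodup := List.nodup_cons.2 ⟨hm, I.nd⟩
    have hsub : ∀ x ∈ u :: C, x ∈ V := by
      intro x hx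
      rcases List.mem_cons.1 hx with rfl | hx
      · exact hu
      · exact I.sub x hx
    have hlen := I.len
    cases n with
    | zero =>
      exfalso
      have : (u :: C).toFinset ⊆ V := fun x hx => hsub x (List.mem_toFinset.1 hx)
      have := Finset.card_le_card this
      rw [List.toFinset_card_of_nodup hnd] at this
      simp at this
      omega
    | succ n => exact ⟨u :: C, n, ⟨hsub, hnd, by simp; omega, I.al⟩, h⟩

theorem srch_sound {V : Finset ℕ} (hV : V.card ≤ 10) (hok : ∀ u ∈ V, ∀ v ∈ V, okN u v = true) :
    ∀ rs : List (ℕ × ℕ × ℕ), (∀ r ∈ rs, ∃ u ∈ V, ∃ v ∈ V, dg r.1 r.2.1 u = true ∧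
      dg r.1 r.2.2 v = true ∧ nbN u v = true) → ∀ C n AL, SInv V C n AL →
      srch rs C n AL = true → False := by
  intro rs
  induction rs with
  | nil => intro _ C n AL _ h; simp [srch] at h
  | cons r rs ih =>
    intro hr C n AL I h
    have ih' := ih (fun r hr' => hr r (List.mem_cons_of_mem _ hr'))
    obtain ⟨u, hu, v, hv, h1, h2, h3⟩ := hr r List.mem_cons_self
    obtain ⟨i, l, s⟩ := r
    rw [srch, cnd_true] at h
    rcases h with ⟨_, h⟩ | ⟨_, h⟩
    · exact ih' C n AL I h
    · obtain ⟨L, hL, h⟩ := filt_use h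
      obtain ⟨M, hM, h⟩ := filt_use h
      rw [allb_iff] at h
      have h := h u ((hL u).2 ⟨I.al u hu, h1⟩)
      rw [allb_iff] at h
      have h := cnd_imp (h v ((hM v).2 ⟨I.al v hv, h2⟩)) h3
      obtain ⟨C', n', I', h⟩ := insK_use hV I hu h
      obtain ⟨C'', n'', I'', h⟩ := insK_use hV I' hv h
      obtain ⟨N, hN, h⟩ := filt_use h
      refine ih' C'' n'' N ⟨I''.sub, I''.nd, I''.len, fun x hx => (hN x).2 ⟨I''.al x hx, ?_⟩⟩ h
      rw [cnd_true]
      exact Or.inl ⟨hok u hu x hx, hok v hv x hx⟩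

theorem start_sound {V : Finset ℕ} (hV : V.card ≤ 10) (hok : ∀ u ∈ V, ∀ v ∈ V, okN u v = true)
    (rs : List (ℕ × ℕ × ℕ)) (hrs : ∀ r ∈ rs, ∃ u ∈ V, ∃ v ∈ V, dg r.1 r.2.1 u = true ∧
      dg r.1 r.2.2 v = true ∧ nbN u v = true) : ∀ P, (∀ x ∈ P, x ∈ V) → ∀ C n AL, SInv V C n AL →
      start rs P C n AL = true → False := by
  intro P
  induction P with
  | nil => intro _ C n AL I h; exact srch_sound hV hok rs hrs C n AL I h
  | cons x P ih =>
    intro hP C n AL I h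
    have hx := hP x List.mem_cons_self
    rw [start] at h
    obtain ⟨C', n', I', h⟩ := insK_use hV I hx h
    obtain ⟨N, hN, h⟩ := filt_use h
    exact ih (fun y hy => hP y (List.mem_cons_of_mem _ hy)) C' n' N
      ⟨I'.sub, I'.nd, I'.len, fun y hy => (hN y).2 ⟨I'.al y hy, hok x hx y hy⟩⟩ h

theorem strs_sound {V : Finset ℕ} (hok : ∀ u ∈ V, ∀ v ∈ V, okN u v = true) (k : List ℕ → Bool)
    (nbl : List ℕ) (w : ℕ → ℕ) : ∀ n j P, (∀ x ∈ P, x ∈ V) → (∀ i < j, w i ∈ P) →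
    (∀ i < j + n, w i ∈ V ∧ w i ∈ nbl ∧ dg (2 * i) 1 (w i) = true ∧
      (no3 (w i) = true ∨ ∃ i' < i, hb (w i) = hb (w i'))) →
    strs k nbl n (2 * j) P = true → ∃ P, (∀ x ∈ P, x ∈ V) ∧ k P = true := by
  intro n
  induction n with
  | zero => intro j P hP _ _ h; exact ⟨P, hP, h⟩
  | succ n ih =>
    intro j P hP hj hw h
    obtain ⟨w1, w2, w3, w4⟩ := hw j (by omega)
    rw [strs, allb_iff] at h
    have h := cnd_imp (h _ w2) w3
    have h := cnd_imp h (by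
      rw [cnd_true]
      by_cases hn : no3 (w j) = true
      · exact Or.inl ⟨hn, rfl⟩
      · right
        refine ⟨by simpa using hn, ?_⟩
        obtain ⟨i', hi, hh⟩ := w4.resolve_left hn
        rw [Bool.not_eq_true', ← Bool.not_eq_true, allb_iff]
        intro hall
        have := hall _ (hj i' hi)
        rw [hh] at this
        simp at this)
    have h := cnd_imp h (by
      rw [allb_iff]
      exact fun x hx => hok _ w1 x (hP x hx))
    refine ih (j+1) (w j :: P) ?_ ?_ (fun i hi => hw i (by omega)) h
    · intro x hx
      rcases List.mem_cons.1 hx with rfl | hx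
      · exact w1
      · exact hP x hx
    · intro i hi
      rcases Nat.lt_succ_iff_lt_or_eq.1 hi with hi | rfl
      · exact List.mem_cons_of_mem _ (hj i hi)
      · exact List.mem_cons_self

theorem chk_sound {m : ℕ} (hm : chk m = true) {V : Finset ℕ} (hV : V.card ≤ 10)
    (hlt : ∀ x ∈ V, x < 4 ^ m) (h0 : 0 ∈ V)
    (hok : ∀ u ∈ V, ∀ v ∈ V, okN u v = true)
    (hrs : ∀ r ∈ sibs m, ∃ u ∈ V, ∃ v ∈ V, dg r.1 r.2.1 u = true ∧
      dg r.1 r.2.2 v = true ∧ nbN u v = true) (w : ℕ → ℕ)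
    (hw : ∀ i < m, w i ∈ V ∧ nbN 0 (w i) = true ∧ dg (2 * i) 1 (w i) = true ∧
      (no3 (w i) = true ∨ ∃ i' < i, hb (w i) = hb (w i'))) : False := by
  unfold chk at hm
  obtain ⟨AL, hAL, h⟩ := filt_use hm
  obtain ⟨nbl, hnb, h⟩ := filt_use h
  have hal : ∀ x ∈ V, x ∈ AL := fun x hx => (hAL x).2 ⟨List.mem_range.2 (hlt x hx), hok 0 h0 x hx⟩
  obtain ⟨P, hP, h⟩ := strs_sound hok _ nbl w m 0 [] (by simp) (by simp) (by
    intro i hi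
    obtain ⟨a, b, c, d⟩ := hw i (by omega)
    exact ⟨a, (hnb _).2 ⟨hal _ a, b⟩, c, d⟩) h
  exact start_sound hV hok _ hrs P hP [0] 9 AL ⟨by simpa using h0, by simp, by simp, hal⟩ h

def Adj {m : ℕ} (v u : Wd m) (i j : Fin m) : Prop :=
  j ≠ i ∧ Cr (v i) (u i) ∧ u j = compl4 (v j) ∧ ∀ k, k ≠ i → k ≠ j → v k = u k

instance {m : ℕ} (v u : Wd m) (i j : Fin m) : Decidable (Adj v u i j) := by
  unfold Adj; infer_instance

def AdjE {m : ℕ} (v u : Wd m) : Prop := ∃ i j, Adj v u i j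

instance {m : ℕ} (v u : Wd m) : Decidable (AdjE v u) := by
  unfold AdjE; infer_instance

theorem Adj.symm {m : ℕ} {v u : Wd m} {i j : Fin m} (h : Adj v u i j) : Adj u v i j :=
  ⟨h.1, h.2.1.symm, by rw [h.2.2.1, cc], fun k h1 h2 => (h.2.2.2 k h1 h2).symm⟩

theorem AdjE.symm {m : ℕ} {v u : Wd m} (h : AdjE v u) : AdjE u v := by
  obtain ⟨i, j, h⟩ := h; exact ⟨i, j, h.symm⟩

theorem Adj.cross_unique {m : ℕ} {v u : Wd m} {i j k : Fin m} (h : Adj v u i j)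
    (hk : Cr (v k) (u k)) : k = i := by
  by_contra hki
  by_cases hkj : k = j
  · subst hkj; exact hk.2 h.2.2.1
  · exact hk.1 (h.2.2.2 k hki hkj).symm

theorem Adj.dir_unique {m : ℕ} {v u : Wd m} {i j k : Fin m} (h : Adj v u i j)
    (hk : u k = compl4 (v k)) : k = j := by
  by_contra hkj
  by_cases hki : k = i
  · subst hki; exact h.2.1.2 hk
  · exact cne (v k) (by rw [← hk, ← h.2.2.2 k hki hkj])

theorem dir_inj {m : ℕ} {V : Finset (Wd m)} (hV : PolyboxCode compl4 V)
    (hT : TwinPairFree compl4 V) {v u w : Wd m} (hu : u ∈ V) (hw : w ∈ V) {i i' j : Fin m}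
    (h : Adj v u i j) (h' : Adj v w i' j) : u = w := by
  by_contra hne
  obtain ⟨k, hk⟩ := hV u hu w hw hne
  have hkj : k ≠ j := by
    rintro rfl
    rw [h.2.2.1, h'.2.2.1, cc] at hk
    exact cne _ hk
  have e : k = i := by
    by_contra hki
    have h1 := h.2.2.2 k hki hkj
    by_cases hki' : k = i'
    · subst hki'
      exact h'.2.1.2 (by rw [hk, h1])
    · have h2 := h'.2.2.2 k hki' hkj
      exact cne (u k) (by rw [← hk, ← h1, h2])
  have e' : k = i' := by
    by_contra hki'
    have h2 := h'.2.2.2 k hki' hkj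
    subst e
    exact h.2.1.symm.2 (by rw [h2, hk])
  subst e
  subst e'
  refine hT u hu w hw ⟨k, hk, fun n hn => ?_⟩
  by_cases hnj : n = j
  · subst hnj
    rw [h.2.2.1, h'.2.2.1]
  · rw [← h.2.2.2 n hn hnj, h'.2.2.2 n hn hnj]

def nbr {m : ℕ} (V : Finset (Wd m)) (v : Wd m) : Finset (Wd m) := V.filter (AdjE v)

theorem mem_nbr {m : ℕ} {V : Finset (Wd m)} {v u : Wd m} : u ∈ nbr V v ↔ u ∈ V ∧ AdjE v u := by
  simp [nbr]

theorem sum_nbr {m : ℕ} {V : Finset (Wd m)} (hS : ∀ i l s, Cr l s → Sib V i l s) :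
    8 * m ≤ ∑ v ∈ V, (nbr V v).card := by
  have e : ∑ v ∈ V, (nbr V v).card = ((V ×ˢ V).filter (fun p => AdjE p.1 p.2)).card := by
    rw [Finset.card_filter, Finset.sum_product]
    apply Finset.sum_congr rfl
    intro v _
    rw [nbr, Finset.card_filter]
  rw [e]
  let T : Finset (Fin m × (Fin 4 × Fin 4)) :=
    Finset.univ ×ˢ (Finset.univ.filter (fun p : Fin 4 × Fin 4 => Cr p.1 p.2))
  have hT : T.card = 8 * m := by
    have : (Finset.univ.filter (fun p : Fin 4 × Fin 4 => Cr p.1 p.2)).card = 8 := by decide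
    rw [Finset.card_product, this, Finset.card_univ, Fintype.card_fin, mul_comm]
  rw [← hT]
  have hex : ∀ q : Fin m × (Fin 4 × Fin 4), ∃ p : Wd m × Wd m, q ∈ T → p.1 ∈ V ∧ p.2 ∈ V ∧
      p.1 q.1 = q.2.1 ∧ p.2 q.1 = q.2.2 ∧ ∃ j, Adj p.1 p.2 q.1 j := by
    intro q
    by_cases hq : q ∈ T
    · have hc : Cr q.2.1 q.2.2 := by simpa [T] using hq
      obtain ⟨v, hv, u, hu, h1, h2, j, hj, h3, h4⟩ := hS q.1 _ _ hc
      exact ⟨(v, u), fun _ => ⟨hv, hu, h1, h2, j, hj, by change Cr (v q.1) (u q.1); rw [h1, h2]; exact hc, h3, h4⟩⟩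
    · exact ⟨(fun _ => 0, fun _ => 0), fun h => absurd h hq⟩
  choose f hf using hex
  apply Finset.card_le_card_of_injOn f
  · intro q hq
    obtain ⟨h1, h2, _, _, j, h3⟩ := hf q hq
    rw [Finset.mem_coe, Finset.mem_filter, Finset.mem_product]
    exact ⟨⟨h1, h2⟩, _, _, h3⟩
  · intro q hq q' hq' hqq
    obtain ⟨_, _, a1, a2, j, h3⟩ := hf q hq
    obtain ⟨_, _, b1, b2, j', h3'⟩ := hf q' hq'
    rw [← hqq] at b1 b2 h3'
    have : q'.1 = q.1 := h3.cross_unique h3'.2.1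
    rw [this] at b1 b2
    exact Prod.ext this.symm (Prod.ext (a1.symm.trans b1) (a2.symm.trans b2))

theorem deg_le {m : ℕ} {V : Finset (Wd m)} (hV : PolyboxCode compl4 V)
    (hT : TwinPairFree compl4 V) (v : Wd m) : (nbr V v).card ≤ m ∧
      (m ≤ (nbr V v).card → ∀ j, ∃ u ∈ V, ∃ i, Adj v u i j) := by
  have hex : ∀ u : nbr V v, ∃ j i, Adj v u i j := by
    intro u
    obtain ⟨_, i, j, h⟩ := mem_nbr.1 u.2
    exact ⟨j, i, h⟩
  choose f hf using hex
  have hinj : Function.Injective f := by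
    intro u w huw
    obtain ⟨i, hi⟩ := hf u
    obtain ⟨i', hi'⟩ := hf w
    rw [← huw] at hi'
    exact Subtype.ext (dir_inj hV hT (mem_nbr.1 u.2).1 (mem_nbr.1 w.2).1 hi hi')
  have hle := Fintype.card_le_of_injective f hinj
  rw [Fintype.card_coe, Fintype.card_fin] at hle
  refine ⟨hle, fun hge j => ?_⟩
  have hb := (Fintype.bijective_iff_injective_and_card f).2
    ⟨hinj, by rw [Fintype.card_coe, Fintype.card_fin]; omega⟩
  obtain ⟨u, hu⟩ := hb.2 j
  obtain ⟨i, hi⟩ := hf u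
  exact ⟨u, (mem_nbr.1 u.2).1, i, hu ▸ hi⟩

theorem star_exists {m : ℕ} (hm : 1 ≤ m) (hm4 : m ≤ 4) {V : Finset (Wd m)}
    (hV : PolyboxCode compl4 V) (hT : TwinPairFree compl4 V) (hc : V.card ≤ 10)
    (hS : ∀ i l s, Cr l s → Sib V i l s) :
    ∃ v ∈ V, ∀ j, ∃ u ∈ V, ∃ i, Adj v u i j := by
  by_contra hno
  push Not at hno
  have h1 : ∀ v ∈ V, (nbr V v).card ≤ m - 1 := by
    intro v hv
    obtain ⟨j, hj⟩ := hno v hv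
    by_contra hlt
    obtain ⟨u, hu, i, hi⟩ := (deg_le hV hT v).2 (by omega) j
    exact hj u hu i hi
  have h2 := sum_nbr hS
  have h3 := Finset.sum_le_card_nsmul V _ _ h1
  rw [smul_eq_mul] at h3
  have h4 : V.card * (m - 1) ≤ 10 * (m - 1) := Nat.mul_le_mul_right _ hc
  omega

/-! encoding -/

def xr (p q : Fin 4) : Fin 4 := ⟨p.val ^^^ q.val, by revert p q; decide⟩

theorem xr_eq : ∀ p q, p = q → xr p q = 0 := by decide
theorem xr_ne : ∀ p q, xr p q = 0 → p = q := by decide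
theorem xr_cp : ∀ p q, q = compl4 p → xr p q = 1 := by decide
theorem xr_cp' : ∀ p q, xr p q = 1 → q = compl4 p := by decide
theorem xr_cr : ∀ p q, Cr p q → xr p q = 2 ∨ xr p q = 3 := by decide

def cd (D : ℕ → Fin 4) : ℕ := (D 0).val + 4 * ((D 1).val + 4 * ((D 2).val + 4 * (D 3).val))

theorem xor_step (p q : Fin 4) (n k : ℕ) :
    (p.val + 4 * n) ^^^ (q.val + 4 * k) = (xr p q).val + 4 * (n ^^^ k) := by
  have h1 : ((p.val + 4 * n) ^^^ (q.val + 4 * k)) % 2 ^ 2 = (xr p q).val := by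
    rw [Nat.xor_mod_two_pow]
    have : (p.val + 4 * n) % 2 ^ 2 = p.val := by omega
    rw [this]
    have : (q.val + 4 * k) % 2 ^ 2 = q.val := by omega
    rw [this]; rfl
  have h2 : ((p.val + 4 * n) ^^^ (q.val + 4 * k)) / 2 ^ 2 = n ^^^ k := by
    rw [Nat.xor_div_two_pow]
    have : (p.val + 4 * n) / 2 ^ 2 = n := by omega
    rw [this]
    have : (q.val + 4 * k) / 2 ^ 2 = k := by omega
    rw [this]
  omega

theorem cd_xor (D E : ℕ → Fin 4) : Nat.xor (cd D) (cd E) = cd (fun k => xr (D k) (E k)) := by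
  change (cd D) ^^^ (cd E) = _
  unfold cd
  rw [xor_step, xor_step, xor_step]
  rfl

theorem ok_dec : ∀ a b c d : Fin 4, (a = 1 ∨ b = 1 ∨ c = 1 ∨ d = 1) →
    ¬ (a = 1 ∧ b = 0 ∧ c = 0 ∧ d = 0) → ¬ (a = 0 ∧ b = 1 ∧ c = 0 ∧ d = 0) →
    ¬ (a = 0 ∧ b = 0 ∧ c = 1 ∧ d = 0) → ¬ (a = 0 ∧ b = 0 ∧ c = 0 ∧ d = 1) →
    tb okM (a.val + 4 * (b.val + 4 * (c.val + 4 * d.val))) = true := by decide +kernel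

theorem forall4 {P : ℕ → Prop} (h0 : P 0) (h1 : P 1) (h2 : P 2) (h3 : P 3) : ∀ k < 4, P k := by
  intro k hk
  interval_cases k <;> assumption

theorem cd_ok {D E : ℕ → Fin 4} (h1 : ∃ k < 4, E k = compl4 (D k))
    (h2 : ¬ ∃ k < 4, E k = compl4 (D k) ∧ ∀ i < 4, i ≠ k → D i = E i) :
    okN (cd D) (cd E) = true := by
  unfold okN
  rw [cd_xor]
  apply ok_dec
  · obtain ⟨k, hk, h⟩ := h1
    have := xr_cp _ _ h
    interval_cases k <;> tauto
  · rintro ⟨a, b, c, d⟩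
    exact h2 ⟨0, by omega, xr_cp' _ _ a, forall4 (by simp) (fun _ => xr_ne _ _ b) (fun _ => xr_ne _ _ c) (fun _ => xr_ne _ _ d)⟩
  · rintro ⟨a, b, c, d⟩
    exact h2 ⟨1, by omega, xr_cp' _ _ b, forall4 (fun _ => xr_ne _ _ a) (by simp) (fun _ => xr_ne _ _ c) (fun _ => xr_ne _ _ d)⟩
  · rintro ⟨a, b, c, d⟩
    exact h2 ⟨2, by omega, xr_cp' _ _ c, forall4 (fun _ => xr_ne _ _ a) (fun _ => xr_ne _ _ b) (by simp) (fun _ => xr_ne _ _ d)⟩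
  · rintro ⟨a, b, c, d⟩
    exact h2 ⟨3, by omega, xr_cp' _ _ d, forall4 (fun _ => xr_ne _ _ a) (fun _ => xr_ne _ _ b) (fun _ => xr_ne _ _ c) (by simp)⟩

theorem okN_self (n : ℕ) : okN n n = true := by
  unfold okN
  have : Nat.xor n n = 0 := Nat.xor_self n
  rw [this]; decide

theorem cd_nb {D E : ℕ → Fin 4} {i j : ℕ} (hi : i < 4) (hj : j < 4) (hij : i ≠ j)
    (h1 : Cr (D i) (E i)) (h2 : E j = compl4 (D j)) (h3 : ∀ k < 4, k ≠ i → k ≠ j → D k = E k) :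
    nbN (cd D) (cd E) = true := by
  unfold nbN
  rw [cd_xor]
  have g1 := xr_cr _ _ h1
  have g2 := xr_cp _ _ h2
  have g3 : ∀ k < 4, k ≠ i → k ≠ j → xr (D k) (E k) = 0 := fun k a b c => xr_eq _ _ (h3 k a b c)
  unfold cd
  have k0 := g3 0 (by omega)
  have k1 := g3 1 (by omega)
  have k2 := g3 2 (by omega)
  have k3 := g3 3 (by omega)
  clear g3 h3 h2 h1
  interval_cases i <;> interval_cases j <;> simp at hij k0 k1 k2 k3 <;>
    rcases g1 with g1 | g1 <;> simp only [*] <;> decide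

theorem dg_dec : ∀ a b c d : Fin 4,
    dg 0 a (a.val + 4 * (b.val + 4 * (c.val + 4 * d.val))) = true ∧
    dg 2 b (a.val + 4 * (b.val + 4 * (c.val + 4 * d.val))) = true ∧
    dg 4 c (a.val + 4 * (b.val + 4 * (c.val + 4 * d.val))) = true ∧
    dg 6 d (a.val + 4 * (b.val + 4 * (c.val + 4 * d.val))) = true := by decide +kernel

theorem cd_dg (D : ℕ → Fin 4) {i : ℕ} (hi : i < 4) : dg (2 * i) (D i).val (cd D) = true := by
  have := dg_dec (D 0) (D 1) (D 2) (D 3)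
  interval_cases i
  · exact this.1
  · exact this.2.1
  · exact this.2.2.1
  · exact this.2.2.2

theorem no3_dec : ∀ a b c d : Fin 4, a ≠ 3 → b ≠ 3 → c ≠ 3 → d ≠ 3 →
    no3 (a.val + 4 * (b.val + 4 * (c.val + 4 * d.val))) = true := by decide +kernel

def hi (a : Fin 4) : Fin 4 := if a = 2 ∨ a = 3 then 2 else 0

theorem hb_dec : ∀ a b c d : Fin 4, hb (a.val + 4 * (b.val + 4 * (c.val + 4 * d.val))) =
    ((hi a).val + 4 * ((hi b).val + 4 * ((hi c).val + 4 * (hi d).val))) := by decide +kernel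

theorem cd_hb {D E : ℕ → Fin 4} (h : ∀ k < 4, hi (D k) = hi (E k)) : hb (cd D) = hb (cd E) := by
  unfold cd
  rw [hb_dec, hb_dec, h 0 (by omega), h 1 (by omega), h 2 (by omega), h 3 (by omega)]

theorem cd_inj {D E : ℕ → Fin 4} (h : cd D = cd E) : ∀ k < 4, D k = E k := by
  unfold cd at h
  apply forall4 <;> apply Fin.ext <;> omega

def nrm (a b x : Fin 4) : Fin 4 :=
  if x = a then 0 else if x = compl4 a then 1 else if x = b then 2 else 3

theorem nrm_compl : ∀ a b x, Cr a b → nrm a b (compl4 x) = compl4 (nrm a b x) := by decide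
theorem nrm_compl' : ∀ a b x y, Cr a b → nrm a b y = compl4 (nrm a b x) → y = compl4 x := by decide
theorem nrm_inj : ∀ a b x y, Cr a b → nrm a b x = nrm a b y → x = y := by decide
theorem nrm_cr : ∀ a b x y, Cr a b → Cr x y → Cr (nrm a b x) (nrm a b y) := by decide
theorem nrm_a : ∀ a b, nrm a b a = 0 := by decide
theorem nrm_ca : ∀ a b, nrm a b (compl4 a) = 1 := by decide
theorem nrm_b : ∀ a b, Cr a b → nrm a b b = 2 := by decide
theorem nrm_cr2 : ∀ a b x, Cr a b → Cr a x → hi (nrm a b x) = 2 := by decide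
theorem nrm_surj : ∀ a b, Cr a b → ∀ l, ∃ x, nrm a b x = l := by decide
theorem nrm_cr' : ∀ a b x y, Cr a b → Cr (nrm a b x) (nrm a b y) → Cr x y := by decide

def pad {m : ℕ} (a b u : Wd m) : ℕ → Fin 4 :=
  fun k => if h : k < m then nrm (a ⟨k, h⟩) (b ⟨k, h⟩) (u ⟨k, h⟩) else 0

theorem pad_lt {m : ℕ} (a b u : Wd m) (k : Fin m) : pad a b u k = nrm (a k) (b k) (u k) := by
  simp [pad]

theorem pad_ge {m : ℕ} (a b u : Wd m) {k : ℕ} (h : ¬ k < m) : pad a b u k = 0 := by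
  simp [pad, h]

theorem core_small {m : ℕ} (hm : 1 ≤ m) (hm4 : m ≤ 4) (hchk : chk m = true)
    (V : Finset (Wd m)) (hV : PolyboxCode compl4 V) (hT : TwinPairFree compl4 V)
    (hc : V.card ≤ 10) (hS : ∀ i l s, Cr l s → Sib V i l s) : False := by
  obtain ⟨a, ha, hst⟩ := star_exists hm hm4 hV hT hc hS
  choose u hu σ hσ using hst
  have hb' : ∀ k, ∃ b, Cr (a k) b ∧ ∀ j, σ j = k → (∀ j' < j, σ j' ≠ k) → u j k = b := by
    intro k
    by_cases hk : ∃ j, σ j = k ∧ ∀ j' < j, σ j' ≠ k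
    · obtain ⟨j, hj, hmin⟩ := hk
      refine ⟨u j k, hj ▸ (hσ j).2.1, fun j2 h2 hmin2 => ?_⟩
      have : j2 = j := by
        rcases lt_trichotomy j2 j with h | h | h
        · exact absurd h2 (hmin _ h)
        · exact h
        · exact absurd hj (hmin2 _ h)
      rw [this]
    · obtain ⟨b, hb⟩ := exCr (a k)
      exact ⟨b, hb, fun j h1 h2 => absurd ⟨j, h1, h2⟩ hk⟩
  choose b hab hb using hb'
  have hpadj : ∀ {v w : Wd m} {i j : Fin m}, Adj v w i j →
      nbN (cd (pad a b v)) (cd (pad a b w)) = true := by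
    intro v w i j h
    refine cd_nb (i := i) (j := j) (by omega) (by omega) (fun h' => h.1 (Fin.ext h'.symm)) ?_ ?_ ?_
    · rw [pad_lt, pad_lt]; exact nrm_cr _ _ _ _ (hab i) h.2.1
    · rw [pad_lt, pad_lt, h.2.2.1, nrm_compl _ _ _ (hab j)]
    · intro k _ hki hkj
      by_cases hk : k < m
      · have := h.2.2.2 ⟨k, hk⟩ (fun h' => hki (by rw [← h'])) (fun h' => hkj (by rw [← h']))
        have e1 := pad_lt a b v ⟨k, hk⟩
        have e2 := pad_lt a b w ⟨k, hk⟩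
        simp only at e1 e2
        rw [e1, e2, this]
      · rw [pad_ge _ _ _ hk, pad_ge _ _ _ hk]
  have hpa : ∀ k, pad a b a k = 0 := by
    intro k
    by_cases hk : k < m
    · have e1 := pad_lt a b a ⟨k, hk⟩
      simp only at e1
      rw [e1, nrm_a]
    · exact pad_ge _ _ _ hk
  have hcda : cd (pad a b a) = 0 := by simp [cd, hpa]
  have hpu : ∀ j k, pad a b (u j) k ≠ 0 → (k = j ∧ pad a b (u j) k = 1) ∨ k = σ j := by
    intro j k hk
    by_cases hkm : k < m
    · have e1 := pad_lt a b (u j) ⟨k, hkm⟩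
      simp only at e1
      by_cases h1 : (⟨k, hkm⟩ : Fin m) = σ j
      · right; rw [← h1]
      · by_cases h2 : (⟨k, hkm⟩ : Fin m) = j
        · left
          refine ⟨by rw [← h2], ?_⟩
          have := (hσ j).2.2.1
          rw [← h2] at this
          rw [e1]
          rw [h2] at this ⊢
          rw [this, nrm_ca]
        · exfalso
          apply hk
          rw [e1, ← (hσ j).2.2.2 _ h1 h2, nrm_a]
    · exact absurd (pad_ge _ _ _ hkm) hk
  have hhi : ∀ j k, hi (pad a b (u j) k) = if k = σ j then 2 else 0 := by
    intro j k
    split_ifs with h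
    · rw [h, pad_lt]
      exact nrm_cr2 _ _ _ (hab _) (hσ j).2.1
    · by_cases h0 : pad a b (u j) k = 0
      · rw [h0]; rfl
      · rcases hpu j k h0 with ⟨_, h1⟩ | h1
        · rw [h1]; rfl
        · exact absurd h1 h
  let g : Wd m → ℕ := fun v => cd (pad a b v)
  refine chk_sound hchk (V := V.image g) (Finset.card_image_le.trans hc) ?_ ?_ ?_ ?_
    (fun i => if h : i < m then g (u ⟨i, h⟩) else 0) ?_
  · intro x hx
    obtain ⟨v, _, rfl⟩ := Finset.mem_image.1 hx
    have h3 : ∀ k, ¬ k < m → (pad a b v k).val = 0 := fun k h => by rw [pad_ge _ _ _ h]; rfl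
    have h1 := h3 1
    have h2 := h3 2
    have h3 := h3 3
    change cd _ < _
    unfold cd
    interval_cases m <;> simp at h1 h2 h3 <;> omega
  · exact Finset.mem_image.2 ⟨a, ha, hcda⟩
  · intro x hx y hy
    obtain ⟨v, hv, rfl⟩ := Finset.mem_image.1 hx
    obtain ⟨w, hw, rfl⟩ := Finset.mem_image.1 hy
    by_cases hvw : v = w
    · rw [hvw]; exact okN_self _
    · apply cd_ok
      · obtain ⟨k, hk⟩ := hV v hv w hw hvw
        exact ⟨k, by omega, by rw [pad_lt, pad_lt, hk, nrm_compl _ _ _ (hab k)]⟩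
      · rintro ⟨k, hk, h1, h2⟩
        by_cases hkm : k < m
        · have e1 := pad_lt a b v ⟨k, hkm⟩
          have e2 := pad_lt a b w ⟨k, hkm⟩
          simp only at e1 e2
          rw [e1, e2] at h1
          refine hT v hv w hw ⟨⟨k, hkm⟩, nrm_compl' _ _ _ _ (hab _) h1, fun i hi => ?_⟩
          have := h2 i (by omega) (fun h => hi (Fin.ext h))
          rw [pad_lt, pad_lt] at this
          exact nrm_inj _ _ _ _ (hab _) this
        · rw [pad_ge _ _ _ hkm, pad_ge _ _ _ hkm] at h1
          exact absurd h1 (by decide)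
  · have key : ∀ i : Fin m, ∀ l s : Fin 4, Cr l s → ∃ x ∈ V.image g, ∃ y ∈ V.image g,
        dg (2 * i) l x = true ∧ dg (2 * i) s y = true ∧ nbN x y = true := by
      intro i l s hls
      obtain ⟨l', hl⟩ := nrm_surj _ _ (hab i) l
      obtain ⟨s', hs⟩ := nrm_surj _ _ (hab i) s
      have hls' : Cr l' s' := nrm_cr' _ _ _ _ (hab i) (by rw [hl, hs]; exact hls)
      obtain ⟨v, hv, w, hw, h1, h2, j, hj, h3, h4⟩ := hS i l' s' hls'
      refine ⟨g v, Finset.mem_image_of_mem _ hv, g w, Finset.mem_image_of_mem _ hw, ?_, ?_,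
        hpadj (i := i) (j := j) ⟨hj, by rw [h1, h2]; exact hls', h3, h4⟩⟩
      · have := cd_dg (pad a b v) (i := i) (by omega)
        rwa [pad_lt, h1, hl] at this
      · have := cd_dg (pad a b w) (i := i) (by omega)
        rwa [pad_lt, h2, hs] at this
    have hmem : ∀ r ∈ sibs m, ∃ i : Fin m, ∃ l s : Fin 4, Cr l s ∧ r = (2 * i.val, l.val, s.val) := by
      clear * - hm hm4
      interval_cases m <;> decide +kernel
    intro r hr
    obtain ⟨i, l, s, hls, rfl⟩ := hmem r hr
    exact key i l s hls
  · intro i hi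
    simp only [hi, dif_pos]
    refine ⟨Finset.mem_image_of_mem _ (hu _), ?_, ?_, ?_⟩
    · have := hpadj (hσ ⟨i, hi⟩)
      rwa [hcda] at this
    · have := cd_dg (pad a b (u ⟨i, hi⟩)) (i := i) (by omega)
      have e1 := pad_lt a b (u ⟨i, hi⟩) ⟨i, hi⟩
      simp only at e1
      rwa [e1, (hσ ⟨i, hi⟩).2.2.1, nrm_ca] at this
    · by_cases hl : ∃ j' < (⟨i, hi⟩ : Fin m), σ j' = σ ⟨i, hi⟩
      · right
        obtain ⟨j', hj', he⟩ := hl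
        refine ⟨j', hj', ?_⟩
        simp only [j'.2, dif_pos]
        apply cd_hb
        intro k _
        rw [hhi, hhi, he]
      · left
        push Not at hl
        have hbb := hb (σ ⟨i, hi⟩) ⟨i, hi⟩ rfl hl
        have : ∀ k, pad a b (u ⟨i, hi⟩) k ≠ 3 := by
          intro k h3
          rcases hpu ⟨i, hi⟩ k (by rw [h3]; decide) with ⟨_, h1⟩ | h1
          · rw [h3] at h1; exact absurd h1 (by decide)
          · rw [h1, pad_lt, hbb, nrm_b _ _ (hab _)] at h3
            exact absurd h3 (by decide)
        exact no3_dec _ _ _ _ (this 0) (this 1) (this 2) (this 3)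

set_option maxRecDepth 100000 in
theorem chk4 : chk 4 = true := by decide +kernel

theorem cr_comp1 {a b c : Fin 4} (h : Cr a b) : Cr b c → ¬ Cr a c := by
  revert a b c; decide

theorem crF1 {m : ℕ} {v u w : Wd m} {i j i' j' : Fin m} (h1 : Adj v u i j) (h2 : Adj u w i' j')
    (k : Fin m) : Cr (v k) (w k) ↔ ((k = i ∧ k ≠ i') ∨ (k ≠ i ∧ k = i')) := by
  have a : Cr (v k) (u k) ↔ k = i := ⟨fun h => h1.cross_unique h, fun h => h ▸ h1.2.1⟩
  have b : Cr (u k) (w k) ↔ k = i' := ⟨fun h => h2.cross_unique h, fun h => h ▸ h2.2.1⟩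
  have e : ∀ p q r : Fin 4, Cr p r ↔ ((Cr p q ∧ ¬ Cr q r) ∨ (¬ Cr p q ∧ Cr q r)) := by decide
  rw [e _ (u k) _, a, b]

theorem crF2 {m : ℕ} {v u w : Wd m} {i j i' j' : Fin m} (h1 : Adj v u i j) (h2 : Adj u w i' j')
    {k : Fin m} (hi : k ≠ i) (hi' : k ≠ i') :
    w k = compl4 (v k) ↔ ((k = j ∧ k ≠ j') ∨ (k ≠ j ∧ k = j')) := by
  have a : u k = compl4 (v k) ↔ k = j := ⟨fun h => h1.dir_unique h, fun h => h ▸ h1.2.2.1⟩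
  have b : w k = compl4 (u k) ↔ k = j' := ⟨fun h => h2.dir_unique h, fun h => h ▸ h2.2.2.1⟩
  have a' : ¬ Cr (v k) (u k) := fun h => hi (h1.cross_unique h)
  have b' : ¬ Cr (u k) (w k) := fun h => hi' (h2.cross_unique h)
  have e : ∀ p q r : Fin 4, ¬ Cr p q → ¬ Cr q r → 
     (r = compl4 p ↔ ((q = compl4 p ∧ ¬ r = compl4 q) ∨ (¬ q = compl4 p ∧ r = compl4 q))) := by decide
  rw [e _ (u k) _ a' b', a, b]

theorem no_tri {m : ℕ} {v u w : Wd m} (h1 : AdjE v u) (h2 : AdjE u w) (h3 : AdjE v w) : False := by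
  obtain ⟨i, j, h1⟩ := h1
  obtain ⟨i', j', h2⟩ := h2
  obtain ⟨p, q, h3⟩ := h3
  have hp := (crF1 h1 h2 p).1 h3.2.1
  have hne : i ≠ i' := by
    rintro rfl
    rcases hp with h | h
    · exact h.2 h.1
    · exact h.1 h.2
  have a := h3.cross_unique ((crF1 h1 h2 i).2 (Or.inl ⟨rfl, hne⟩))
  have b := h3.cross_unique ((crF1 h1 h2 i').2 (Or.inr ⟨hne.symm, rfl⟩))
  exact hne (a.trans b.symm)

def cmn {m : ℕ} (V : Finset (Wd m)) (v w : Wd m) : Finset (Wd m) :=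
  V.filter (fun u => AdjE v u ∧ AdjE u w)

theorem cmn_le {m : ℕ} {V : Finset (Wd m)} (hV : PolyboxCode compl4 V)
    (hT : TwinPairFree compl4 V) {v w : Wd m} (hv : v ∈ V) (hw : w ∈ V) (hne : v ≠ w) :
    (cmn V v w).card ≤ 2 ∨ ((cmn V v w).card = 3 ∧ ∃ D : Finset (Fin m), D.card = 3 ∧
      (∀ k, w k = if k ∈ D then compl4 (v k) else v k) ∧
      ∀ k ∈ D, ∃ u ∈ V, ∃ i ∈ D, Adj v u i k) := by
  have hex : ∀ u, ∃ q : (Fin m × Fin m) × (Fin m × Fin m), u ∈ cmn V v w →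
      u ∈ V ∧ Adj v u q.1.1 q.1.2 ∧ Adj u w q.2.1 q.2.2 := by
    intro u
    by_cases hu : u ∈ cmn V v w
    · obtain ⟨hu, ⟨i, j, h⟩, i', j', h'⟩ := Finset.mem_filter.1 hu
      exact ⟨((i, j), (i', j')), fun _ => ⟨hu, h, h'⟩⟩
    · obtain ⟨j, hj⟩ := hV v hv w hw hne
      exact ⟨((j, j), (j, j)), fun h => absurd h hu⟩
  choose f hf using hex
  have inj1 : ∀ u ∈ cmn V v w, ∀ u' ∈ cmn V v w, (f u).1.2 = (f u').1.2 → u = u' := by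
    intro u hu u' hu' h
    have := (hf u' hu').2.1
    rw [← h] at this
    exact dir_inj hV hT (hf u hu).1 (hf u' hu').1 (hf u hu).2.1 this
  have inj2 : ∀ u ∈ cmn V v w, ∀ u' ∈ cmn V v w, (f u).2.2 = (f u').2.2 → u = u' := by
    intro u hu u' hu' h
    have := (hf u' hu').2.2
    rw [← h] at this
    exact dir_inj hV hT (hf u hu).1 (hf u' hu').1 (hf u hu).2.2.symm this.symm
  by_cases hx : ∃ k, Cr (v k) (w k)
  · left
    obtain ⟨p, hp⟩ := hx
    obtain ⟨c, hc⟩ := hV v hv w hw hne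
    have hsub : cmn V v w ⊆ (cmn V v w).filter (fun u => (f u).1.2 = c) ∪
        (cmn V v w).filter (fun u => (f u).2.2 = c) := by
      intro u hu
      obtain ⟨_, h1, h2⟩ := hf u hu
      have hp' := (crF1 h1 h2 p).1 hp
      have hii : (f u).1.1 ≠ (f u).2.1 := by
        intro h
        rw [h] at hp'
        tauto
      have hcn : ¬ Cr (v c) (w c) := fun h => h.2 hc
      rw [crF1 h1 h2 c] at hcn
      have hci : c ≠ (f u).1.1 := by
        intro h; exact hcn (Or.inl ⟨h, h ▸ hii⟩)
      have hci' : c ≠ (f u).2.1 := by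
        intro h; exact hcn (Or.inr ⟨hci, h⟩)
      have := (crF2 h1 h2 hci hci').1 hc
      rw [Finset.mem_union, Finset.mem_filter, Finset.mem_filter]
      rcases this with h | h
      · exact Or.inl ⟨hu, h.1.symm⟩
      · exact Or.inr ⟨hu, h.2.symm⟩
    have c1 : ((cmn V v w).filter (fun u => (f u).1.2 = c)).card ≤ 1 := by
      rw [Finset.card_le_one]
      intro a ha b hb
      rw [Finset.mem_filter] at ha hb
      exact inj1 a ha.1 b hb.1 (ha.2.trans hb.2.symm)
    have c2 : ((cmn V v w).filter (fun u => (f u).2.2 = c)).card ≤ 1 := by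
      rw [Finset.card_le_one]
      intro a ha b hb
      rw [Finset.mem_filter] at ha hb
      exact inj2 a ha.1 b hb.1 (ha.2.trans hb.2.symm)
    have := Finset.card_le_card hsub
    have := Finset.card_union_le ((cmn V v w).filter (fun u => (f u).1.2 = c))
      ((cmn V v w).filter (fun u => (f u).2.2 = c))
    omega
  · push Not at hx
    by_cases hle : (cmn V v w).card ≤ 2
    · exact Or.inl hle
    right
    have hii : ∀ u ∈ cmn V v w, (f u).1.1 = (f u).2.1 := by
      intro u hu
      obtain ⟨_, h1, h2⟩ := hf u hu
      by_contra h
      exact hx _ ((crF1 h1 h2 (f u).1.1).2 (Or.inl ⟨rfl, h⟩))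
    have hwk : ∀ k, w k ≠ compl4 (v k) → w k = v k := by
      intro k hk
      rcases tri (v k) (w k) with h | h | h
      · exact h
      · exact absurd h hk
      · exact absurd h (hx k)
    have hjj : ∀ u ∈ cmn V v w, (f u).1.2 ≠ (f u).2.2 := by
      intro u hu h
      obtain ⟨_, h1, h2⟩ := hf u hu
      have hi := hii u hu
      have hk : ∀ k, k ≠ (f u).1.1 → w k = v k := by
        intro k hk
        apply hwk
        rw [Ne, crF2 h1 h2 hk (hi ▸ hk), h]
        tauto
      by_cases h0 : w (f u).1.1 = compl4 (v (f u).1.1)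
      · exact hT v hv w hw ⟨_, h0, fun k hk' => (hk k hk').symm⟩
      · apply hne
        funext k
        by_cases hk' : k = (f u).1.1
        · rw [hk']; exact (hwk _ h0).symm
        · exact (hk k hk').symm
    let D : Finset (Fin m) := Finset.univ.filter (fun k => w k = compl4 (v k))
    have hDsub : ∀ u ∈ cmn V v w, D ⊆ {(f u).1.1, (f u).1.2, (f u).2.2} := by
      intro u hu k hk
      obtain ⟨_, h1, h2⟩ := hf u hu
      have hk : w k = compl4 (v k) := by simpa [D] using hk
      by_cases hki : k = (f u).1.1
      · simp [hki]
      · rw [crF2 h1 h2 hki (hii u hu ▸ hki)] at hk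
        simp only [Finset.mem_insert, Finset.mem_singleton]
        tauto
    have hcard3 : D.card ≤ 3 := by
      have : 0 < (cmn V v w).card := by omega
      obtain ⟨u, hu⟩ := Finset.card_pos.1 this
      exact (Finset.card_le_card (hDsub u hu)).trans Finset.card_le_three
    have hjD : ∀ u ∈ cmn V v w, (f u).1.2 ∈ D := by
      intro u hu
      obtain ⟨_, h1, h2⟩ := hf u hu
      have : w (f u).1.2 = compl4 (v (f u).1.2) :=
        (crF2 h1 h2 h1.1 (hii u hu ▸ h1.1)).2 (Or.inl ⟨rfl, hjj u hu⟩)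
      simpa [D] using this
    have himg : ((cmn V v w).image (fun u => (f u).1.2)).card = (cmn V v w).card :=
      Finset.card_image_of_injOn (fun a ha b hb h => inj1 a ha b hb h)
    have hsub : (cmn V v w).image (fun u => (f u).1.2) ⊆ D := by
      intro k hk
      obtain ⟨u, hu, rfl⟩ := Finset.mem_image.1 hk
      exact hjD u hu
    have hl := Finset.card_le_card hsub
    have hD3 : D.card = 3 := by omega
    refine ⟨by omega, D, hD3, ?_, ?_⟩
    · intro k
      by_cases hk : w k = compl4 (v k)
      · simp [D, hk]
      · rw [if_neg (by simpa [D] using hk)]; exact hwk k hk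
    · intro k hk
      have heq := Finset.eq_of_subset_of_card_le hsub (by omega)
      rw [← heq] at hk
      obtain ⟨u, hu, rfl⟩ := Finset.mem_image.1 hk
      obtain ⟨h0, h1, h2⟩ := hf u hu
      refine ⟨u, h0, (f u).1.1, ?_, h1⟩
      have : D = {(f u).1.1, (f u).1.2, (f u).2.2} :=
        Finset.eq_of_subset_of_card_le (hDsub u hu) (by rw [hD3]; exact Finset.card_le_three)
      rw [this]; simp

theorem no2cyc {m : ℕ} {V : Finset (Wd m)} (hV : PolyboxCode compl4 V)
    {v u u' : Wd m} {i k : Fin m} (hu : u ∈ V) (hu' : u' ∈ V) (h : Adj v u i k)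
    (h' : Adj v u' k i) : False := by
  have hne : u ≠ u' := by
    rintro rfl
    exact h'.2.1.2 h.2.2.1
  obtain ⟨n, hn⟩ := hV u hu u' hu' hne
  by_cases hni : n = i
  · subst hni
    have a := h.2.1
    have b := h'.2.2.1
    rw [b] at hn
    exact a.1 (cinj hn).symm
  · by_cases hnk : n = k
    · subst hnk
      have a := h'.2.1
      rw [h.2.2.1, cc] at hn
      exact a.1 hn
    · rw [← h.2.2.2 n hni hnk, ← h'.2.2.2 n hnk hni] at hn
      exact cne _ hn.symm

theorem D_unique {V : Finset (Wd 5)} (hV : PolyboxCode compl4 V)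
    (hT : TwinPairFree compl4 V) {v : Wd 5} {D E : Finset (Fin 5)} (hD : D.card = 3)
    (hE : E.card = 3) (h1 : ∀ k ∈ D, ∃ u ∈ V, ∃ i ∈ D, Adj v u i k)
    (h2 : ∀ k ∈ E, ∃ u ∈ V, ∃ i ∈ E, Adj v u i k) : D = E := by
  have step : ∀ k, k ∈ D ∩ E → ∃ u ∈ V, ∃ i ∈ D ∩ E, Adj v u i k := by
    intro k hk
    rw [Finset.mem_inter] at hk
    obtain ⟨u, hu, i, hi, ha⟩ := h1 k hk.1
    obtain ⟨u', hu', i', hi', ha'⟩ := h2 k hk.2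
    have := dir_inj hV hT hu hu' ha ha'
    subst this
    have := ha.cross_unique ha'.2.1
    subst this
    exact ⟨u, hu, _, Finset.mem_inter.2 ⟨hi, hi'⟩, ha⟩
  have hne : (D ∩ E).Nonempty := by
    rw [← Finset.card_pos]
    have := Finset.card_union_add_card_inter D E
    have h5 : (D ∪ E).card ≤ 5 := by simpa using Finset.card_le_univ (D ∪ E)
    omega
  obtain ⟨k, hk⟩ := hne
  obtain ⟨u, hu, i, hi, ha⟩ := step k hk
  obtain ⟨u', hu', p, hp, ha'⟩ := step i hi
  have hpk : p ≠ k := by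
    rintro rfl
    exact no2cyc hV hu hu' ha ha'
  have hsub : ({k, i, p} : Finset (Fin 5)) ⊆ D ∩ E := by
    intro n hn
    simp only [Finset.mem_insert, Finset.mem_singleton] at hn
    rcases hn with rfl | rfl | rfl <;> assumption
  have hc : ({k, i, p} : Finset (Fin 5)).card = 3 :=
    Finset.card_eq_three.2 ⟨k, i, p, ha.1, hpk.symm, ha'.1, rfl⟩
  have h3 := Finset.card_le_card hsub
  have e1 : D ∩ E = D := Finset.eq_of_subset_of_card_le Finset.inter_subset_left (by omega)
  have e2 : D ∩ E = E := Finset.eq_of_subset_of_card_le Finset.inter_subset_right (by omega)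
  exact e1.symm.trans e2

theorem nbr_self {m : ℕ} {v : Wd m} : ¬ AdjE v v := by
  rintro ⟨i, j, h⟩
  exact h.2.1.1 rfl

theorem cmn_sum {V : Finset (Wd 5)} (hV : PolyboxCode compl4 V)
    (hT : TwinPairFree compl4 V) {v : Wd 5} (hv : v ∈ V) :
    (∑ w ∈ V, (cmn V v w).card) + (nbr V v).card + 1 ≤ 2 * V.card := by
  let E := V.filter (fun w => w ≠ v ∧ (cmn V v w).card = 3)
  have hE : E.card ≤ 1 := by
    rw [Finset.card_le_one]
    intro a ha b hb
    obtain ⟨ha, ha1, ha2⟩ := Finset.mem_filter.1 ha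
    obtain ⟨hb, hb1, hb2⟩ := Finset.mem_filter.1 hb
    rcases cmn_le hV hT hv ha ha1.symm with h | ⟨_, D, hD, hDa, hDs⟩
    · omega
    rcases cmn_le hV hT hv hb hb1.symm with h | ⟨_, D', hD', hDb, hDs'⟩
    · omega
    have := D_unique hV hT hD hD' hDs hDs'
    subst this
    funext k
    rw [hDa, hDb]
  have pw : ∀ w ∈ V, (cmn V v w).card + (if w = v then 2 else 0) + (if AdjE v w then 2 else 0) ≤
      2 + (if w = v then (nbr V v).card else 0) + (if w ∈ E then 1 else 0) := by
    intro w hw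
    by_cases hwv : w = v
    · subst hwv
      rw [if_pos rfl, if_neg nbr_self, if_pos rfl]
      have : cmn V w w ⊆ nbr V w := by
        intro u hu
        obtain ⟨h1, h2, _⟩ := Finset.mem_filter.1 hu
        exact mem_nbr.2 ⟨h1, h2⟩
      have := Finset.card_le_card this
      omega
    · rw [if_neg hwv, if_neg hwv]
      by_cases ha : AdjE v w
      · have : cmn V v w = ∅ := by
          rw [Finset.eq_empty_iff_forall_notMem]
          intro u hu
          obtain ⟨h1, h2, h3⟩ := Finset.mem_filter.1 hu
          exact no_tri h2 h3 ha
        rw [if_pos ha, this]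
        simp
      · rw [if_neg ha]
        rcases cmn_le hV hT hv hw (Ne.symm hwv) with h | ⟨h, _⟩
        · omega
        · rw [if_pos (Finset.mem_filter.2 ⟨hw, hwv, h⟩), h]
  have hs := Finset.sum_le_sum pw
  simp only [Finset.sum_add_distrib] at hs
  have e1 : ∑ w ∈ V, (if w = v then 2 else 0) = 2 := by rw [Finset.sum_ite_eq']; simp [hv]
  have e2 : ∑ w ∈ V, (if w = v then (nbr V v).card else 0) = (nbr V v).card := by
    rw [Finset.sum_ite_eq']; simp [hv]
  have e3 : ∑ w ∈ V, (if AdjE v w then 2 else 0) = 2 * (nbr V v).card := by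
    rw [nbr, Finset.card_filter, Finset.mul_sum]
    apply Finset.sum_congr rfl
    intro w _
    split_ifs <;> rfl
  have e4 : ∑ w ∈ V, (if w ∈ E then 1 else 0) ≤ 1 := by
    rw [← Finset.card_filter]
    refine le_trans (Finset.card_le_card ?_) hE
    intro w hw
    exact (Finset.mem_filter.1 hw).2
  rw [e1, e2, e3, Finset.sum_const, smul_eq_mul] at hs
  omega

theorem core5 {V : Finset (Wd 5)} (hV : PolyboxCode compl4 V)
    (hT : TwinPairFree compl4 V) (hc : V.card ≤ 10)
    (hS : ∀ i l s, Cr l s → Sib V i l s) : False := by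
  have h40 := sum_nbr hS
  have hs := Finset.sum_le_sum (fun v (hv : v ∈ V) => cmn_sum hV hT hv)
  simp only [Finset.sum_add_distrib, Finset.sum_const, smul_eq_mul] at hs
  have hdc : ∑ v ∈ V, ∑ w ∈ V, (cmn V v w).card = ∑ u ∈ V, (nbr V u).card * (nbr V u).card := by
    have : ∀ v w, (cmn V v w).card =
        ∑ u ∈ V, (if AdjE u v then 1 else 0) * (if AdjE u w then 1 else 0) := by
      intro v w
      rw [cmn, Finset.card_filter]
      apply Finset.sum_congr rfl
      intro u _
      have a : AdjE v u ↔ AdjE u v := ⟨AdjE.symm, AdjE.symm⟩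
      by_cases h1 : AdjE u v <;> by_cases h2 : AdjE u w <;> simp [a, h1, h2]
    simp_rw [this]
    rw [Finset.sum_comm' (t' := V) (s' := fun _ => V) (by simp)]
    rw [Finset.sum_congr rfl (fun w _ => Finset.sum_comm)]
    rw [Finset.sum_comm]
    apply Finset.sum_congr rfl
    intro u _
    rw [nbr, Finset.card_filter, Finset.sum_mul_sum, Finset.sum_comm]
  rw [hdc] at hs
  have hq : ∀ v ∈ V, 8 * (nbr V v).card ≤ (nbr V v).card * (nbr V v).card + 16 := by
    intro v _
    zify
    nlinarith [sq_nonneg (((nbr V v).card : ℤ) - 4)]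
  have hq' := Finset.sum_le_sum hq
  rw [← Finset.mul_sum, Finset.sum_add_distrib, Finset.sum_const, smul_eq_mul] at hq'
  generalize V.card = n at *
  have : n * (2 * n) ≤ n * 20 := Nat.mul_le_mul_left _ (by omega)
  interval_cases n <;> omega

theorem T4 : TProp 4 :=
  T_step (T_step (T_step (T_step T_zero
    (fun V h1 h2 h3 h4 => core_small (by omega) (by omega) chk1 V h1 h2 h3 h4))
    (fun V h1 h2 h3 h4 => core_small (by omega) (by omega) chk2 V h1 h2 h3 h4))
    (fun V h1 h2 h3 h4 => core_small (by omega) (by omega) chk3 V h1 h2 h3 h4))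
    (fun V h1 h2 h3 h4 => core_small (by omega) (by omega) chk4 V h1 h2 h3 h4)

theorem T5 : TProp 5 := T_step T4 (fun _ h1 h2 h3 h4 => core5 h1 h2 h3 h4)

theorem flip_same {m : ℕ} (t : Wd m) (k : Fin m) : flip t {k} k = compl4 (t k) := by simp [flip]
theorem flip_off {m : ℕ} (t : Wd m) {k j : Fin m} (h : j ≠ k) : flip t {k} j = t j := by
  simp [flip, h]

theorem in_flip {m : ℕ} {d x t : Wd m} {k : Fin m} (h : In d x t) (hk : d k = x k) :
    In d x (flip t {k}) := by
  intro j
  by_cases hj : j = k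
  · subst hj; exact Or.inl hk
  · rw [flip_off t hj]; exact h j

theorem in_flip' {m : ℕ} {d x t : Wd m} {k : Fin m} (h : In d x (flip t {k})) (hk : d k = x k) :
    In d x t := by
  intro j
  by_cases hj : j = k
  · subst hj; exact Or.inl hk
  · have := h j
    rwa [flip_off t hj] at this

theorem in_both {m : ℕ} {d x t : Wd m} {k : Fin m} (h : In d x t)
    (h' : In d x (flip t {k})) : d k = x k := by
  rcases h k with h1 | h1
  · exact h1
  · rcases h' k with h2 | h2
    · exact h2
    · rw [flip_same, h1] at h2
      exact absurd h2.symm (cne _)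

theorem flipcell {m : ℕ} {C : Finset (Wd m)} (hC : PolyboxCode compl4 C) {z : Wd m}
    (h : CovW C z) {c t : Wd m} {k : Fin m} (hc : c ∈ C) (hp : Pt z t) (hi : In c z t)
    (hk : c k ≠ z k) : ∃ d ∈ C, In d z (flip t {k}) ∧ d k = compl4 (c k) := by
  obtain ⟨d, hd, hi'⟩ := h _ (flip_pt hp {k})
  refine ⟨d, hd, hi', ?_⟩
  have hct : c k = t k := (hi k).resolve_left hk
  rcases hi' k with h1 | h1
  · have := code_eq hC hc hd hp hi (in_flip' hi' h1)
    subst this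
    exact absurd h1 hk
  · rw [h1, flip_same, hct]

theorem lemmaQ {m : ℕ} {C : Finset (Wd (m+1))} (hC : PolyboxCode compl4 C)
    (hT : TwinPairFree compl4 C) {z e : Wd (m+1)} (h : CovW C z) {k : Fin (m+1)} {p : Fin 4}
    (hkp : Cr (z k) p) (he : e ∈ mt C z) (hek : e k = compl4 p)
    (hu : ∀ c ∈ mt C z, c k = compl4 p → c = e) : 5 ≤ (sl k p (mt C z)).card := by
  have heC := mt_sub _ _ he
  apply lemma5' (x := fun j => e (k.succAbove j)) (sl_code (code_mono (mt_sub _ _) hC) k p)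
    (sl_tf (tf_mono (mt_sub _ _) hT) k p)
  · intro t ht
    let T : Wd (m+1) := fun j => if e j ≠ z j then e j else (ins k p t) j
    have hTe : ∀ j, e j ≠ z j → T j = e j := fun j hj => by simp only [T]; rw [if_pos hj]
    have hTn : ∀ j, e j = z j → T j = (ins k p t) j := fun j hj => by
      simp only [T]; rw [if_neg (not_not.2 hj)]
    have hekz : e k ≠ z k := by rw [hek]; exact hkp.compl.1
    have hPT : Pt z T := by
      intro j
      by_cases hj : e j = z j
      · rw [hTn j hj]
        rcases Fin.eq_self_or_eq_succAbove k j with rfl | ⟨n, rfl⟩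
        · exact absurd hj hekz
        · have := ht n
          rw [← hj]
          simpa using this
      · rw [hTe j hj]
        exact ⟨hj, (Finset.mem_filter.1 he).2 j⟩
    have hIT : In e z T := by
      intro j
      by_cases hj : e j = z j
      · exact Or.inl hj
      · exact Or.inr (hTe j hj).symm
    obtain ⟨d, hd, hid, hdk⟩ := flipcell hC h heC hPT hIT hekz
    rw [hek, cc] at hdk
    have hdm := in_mt hd (flip_pt hPT {k}) hid
    have hdD := rem_mem_sl (i := k) hdm
    rw [hdk] at hdD
    refine ⟨_, hdD, ?_⟩
    intro n
    have hne : k.succAbove n ≠ k := Fin.succAbove_ne k n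
    have h1 := hid (k.succAbove n)
    rw [flip_off T hne] at h1
    by_cases hj : e (k.succAbove n) = z (k.succAbove n)
    · rw [hTn _ hj] at h1
      simp only [ins, Fin.insertNth_apply_succAbove] at h1
      beta_reduce
      rw [hj]; exact h1
    · rw [hTe _ hj] at h1
      rcases h1 with h1 | h1
      · exfalso
        have h2 := in_flip hid h1
        obtain ⟨g, hg, hig, hgk⟩ := flipcell hC h hd (flip_pt (flip_pt hPT {k}) _) h2
          (k := k) (by rw [hdk]; exact hkp.1)
        rw [hdk] at hgk
        have hge := hu g (in_mt hg (flip_pt (flip_pt (flip_pt hPT {k}) _) _) hig) hgk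
        rw [hge] at hig
        have := hig (k.succAbove n)
        rw [flip_off _ hne, flip_same, flip_off _ hne, hTe _ hj] at this
        rcases this with this | this
        · exact hj this
        · exact cne _ this.symm
      · exact Or.inl h1
  · intro hmem
    have h1 : (fun j => e (k.succAbove j)) ∈ sl k p C := mem_sl.2 (mt_sub _ _ (mem_sl.1 hmem))
    have h2 := rem_mem_sl (i := k) heC
    rw [hek] at h2
    exact sl_opp hT h1 h2

theorem cov_single {m : ℕ} {C : Finset (Wd m)} {x y : Wd m} (h : CovW C x) (hC : ∀ c ∈ C, c = y) :
    y = x := by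
  have : ∃ t, Pt x t := by
    choose t ht using fun j => exCr (x j)
    exact ⟨t, ht⟩
  obtain ⟨t, ht⟩ := this
  have key : ∀ s, Pt x s → In y x s := by
    intro s hs
    obtain ⟨c, hc, hi⟩ := h s hs
    rwa [hC c hc] at hi
  funext k
  exact in_both (key t ht) (key _ (flip_pt ht {k}))

theorem cov_sl {m : ℕ} {C : Finset (Wd (m+1))} {i : Fin (m+1)} {x : Wd (m+1)} {a : Fin 4}
    (h : CovW C x) (ha : Cr (x i) a) (hn : ∀ c ∈ C, c i ≠ x i) :
    CovW (sl i a C) (fun j => x (i.succAbove j)) := by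
  intro t ht
  obtain ⟨c, hc, hi⟩ := h (ins i a t) (by
    rw [← ins_rem i x, pt_ins]; exact ⟨ha, ht⟩)
  have hca : c i = a := by
    rcases hi i with h1 | h1
    · exact absurd h1 (hn c hc)
    · simpa using h1
  refine ⟨_, hca ▸ rem_mem_sl (i := i) hc, fun j => ?_⟩
  have := hi (i.succAbove j)
  simpa using this

theorem lem0 {m : ℕ} {C : Finset (Wd (m+1))} (hC : PolyboxCode compl4 C)
    (hT : TwinPairFree compl4 C) (hc6 : C.card ≤ 6) {x y : Wd (m+1)} (hx : CovW C x)
    (hy : CovW C y) {i : Fin (m+1)} (hi : y i = compl4 (x i)) (hnt : ¬ TwinPair compl4 x y) :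
    ∃ e ∈ C, e i = x i := by
  by_contra hno
  push Not at hno
  obtain ⟨a, ha⟩ := exCr (x i)
  have key : ∀ a, Cr (x i) a → (fun j => x (i.succAbove j)) ∈ sl i a C → False := by
    intro a ha hmem
    have hsp := card_split C i ha
    have h2 := cov_sl hx ha.compl hno
    have hnm : (fun j => x (i.succAbove j)) ∉ sl i (compl4 a) C := fun h => sl_opp hT hmem h
    have h5 := lemma5' (sl_code hC i _) (sl_tf hT i _) h2 hnm
    have hpos := Finset.card_pos.2 ⟨_, hmem⟩
    have hy0 : (sl i (compl4 (x i)) C).card = 0 := by omega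
    have h1 : (sl i a C).card ≤ 1 := by omega
    have hny : ∀ c ∈ C, c i ≠ y i := by
      intro c hc hci
      rw [hi] at hci
      have := rem_mem_sl (i := i) hc
      rw [hci, Finset.card_eq_zero.1 hy0] at this
      simp at this
    have h3 := cov_sl hy (a := a) (by rw [hi]; exact ha.compl_left) hny
    have h4 := cov_single h3 (fun c hc => Finset.card_le_one.1 h1 c hc _ hmem)
    refine hnt ⟨i, hi, fun k hk => ?_⟩
    rcases Fin.eq_self_or_eq_succAbove i k with rfl | ⟨n, rfl⟩
    · exact absurd rfl hk
    · exact congrFun h4 n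
  have hsp := card_split C i ha
  have e1 := lemma5' (sl_code hC i _) (sl_tf hT i _) (cov_sl hx ha hno) (key a ha)
  have e2 := lemma5' (sl_code hC i _) (sl_tf hT i _) (cov_sl hx ha.compl hno) (key _ ha.compl)
  omega

theorem f2 {m : ℕ} {C : Finset (Wd (m+1))} (hC : PolyboxCode compl4 C)
    (hT : TwinPairFree compl4 C) (hc6 : C.card ≤ 6) {x y : Wd (m+1)} (hx : CovW C x)
    (hy : CovW C y) (hxC : x ∉ C) (hyC : y ∉ C) (hd : Dichotomous compl4 x y)
    (hnt : ¬ TwinPair compl4 x y) : False := by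
  obtain ⟨i, hi⟩ := hd
  have hi' : x i = compl4 (y i) := by rw [hi, cc]
  have l5x := lemma5 hC hT hx hxC
  have l5y := lemma5 hC hT hy hyC
  have hnt' : ¬ TwinPair compl4 y x := fun h => hnt (twin_symm h)
  -- uniqueness of words outside
  have ux : ∀ c ∈ C, ∀ d ∈ C, c ∉ mt C x → d ∉ mt C x → c = d := by
    intro c hc d hd h1 h2
    have : (C \ mt C x).card ≤ 1 := by
      rw [Finset.card_sdiff_of_subset (mt_sub _ _)]; omega
    exact Finset.card_le_one.1 this c (Finset.mem_sdiff.2 ⟨hc, h1⟩) d (Finset.mem_sdiff.2 ⟨hd, h2⟩)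
  have uy : ∀ c ∈ C, ∀ d ∈ C, c ∉ mt C y → d ∉ mt C y → c = d := by
    intro c hc d hd h1 h2
    have : (C \ mt C y).card ≤ 1 := by
      rw [Finset.card_sdiff_of_subset (mt_sub _ _)]; omega
    exact Finset.card_le_one.1 this c (Finset.mem_sdiff.2 ⟨hc, h1⟩) d (Finset.mem_sdiff.2 ⟨hd, h2⟩)
  have nmt : ∀ (z c : Wd (m+1)) k, c k = compl4 (z k) → c ∉ mt C z := fun z c k h h' =>
    (Finset.mem_filter.1 h').2 k h
  obtain ⟨e, heC, hei⟩ := lem0 hC hT hc6 hx hy hi hnt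
  obtain ⟨e', heC', hei'⟩ := lem0 hC hT hc6 hy hx hi' hnt'
  have hey : e ∉ mt C y := nmt y e i (by rw [hei, hi'])
  have hex' : e' ∉ mt C x := nmt x e' i (by rw [hei', hi])
  have lt : ∀ z c, c ∈ C → c ∉ mt C z → (mt C z).card < C.card := fun z c h1 h2 =>
    Finset.card_lt_card ⟨mt_sub _ _, fun h => h2 (h h1)⟩
  have ltx := lt x e' heC' hex'
  have lty := lt y e heC hey
  -- cross coordinate
  have cross : ∀ x y : Wd (m+1), CovW C x → (mt C x).card < C.card →
      (∀ c ∈ C, ∀ d ∈ C, c ∉ mt C y → d ∉ mt C y → c = d) → 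
      ∀ k, Cr (x k) (y k) → ∀ c ∈ mt C x, c k ≠ compl4 (y k) ∧ c k ≠ y k := by
    intro x y hx ltx uy k hk
    have A : ∀ c ∈ mt C x, c k ≠ compl4 (y k) := by
      intro c hc hck
      have h5 := lemmaQ hC hT hx hk hc hck (fun d hd hdk =>
        uy d (mt_sub _ _ hd) c (mt_sub _ _ hc) (nmt y d k hdk) (nmt y c k hck))
      rw [sl_card] at h5
      have : ((mt C x).filter (fun v => v k = y k)).card < (mt C x).card := by
        apply Finset.card_lt_card
        refine ⟨Finset.filter_subset _ _, fun h => ?_⟩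
        have := (Finset.mem_filter.1 (h hc)).2
        rw [hck] at this
        exact cne _ this
      omega
    intro c hc
    refine ⟨A c hc, fun hck => ?_⟩
    obtain ⟨t, hp, ht⟩ := ext_t (Finset.mem_filter.1 hc).2
    have hin : In c x t := by
      intro j
      by_cases hj : c j = x j
      · exact Or.inl hj
      · exact Or.inr (ht j hj).symm
    obtain ⟨d, hd, hid, hdk⟩ := flipcell hC hx (mt_sub _ _ hc) hp hin (k := k)
      (by rw [hck]; exact hk.1)
    exact A d (in_mt hd (flip_pt hp _) hid) (by rw [hdk, hck])
  have hS : (mt C x ∩ mt C y).Nonempty := by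
    rw [← Finset.card_pos]
    have := Finset.card_union_add_card_inter (mt C x) (mt C y)
    have h5 := Finset.card_le_card (Finset.union_subset (mt_sub C x) (mt_sub C y))
    omega
  by_cases hcr : ∃ k, Cr (x k) (y k)
  · obtain ⟨k, hk⟩ := hcr
    obtain ⟨c, hc⟩ := hS
    rw [Finset.mem_inter] at hc
    have h1 := cross x y hx ltx uy k hk c hc.1
    have h2 := cross y x hy lty ux k hk.symm c hc.2
    rcases cases4 hk (c k) with h | h | h | h <;> tauto
  · push Not at hcr
    have hz : ∃ z, z ≠ i ∧ y z = compl4 (x z) := by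
      by_contra hz
      push Not at hz
      refine hnt ⟨i, hi, fun k hk => ?_⟩
      rcases tri (x k) (y k) with h | h | h
      · exact h.symm
      · exact absurd h (hz k hk)
      · exact absurd h (hcr k)
    obtain ⟨z, hzi, hz⟩ := hz
    have hz' : x z = compl4 (y z) := by rw [hz, cc]
    have hez : e z = x z := by
      obtain ⟨g, hg, hgz⟩ := lem0 hC hT hc6 hx hy hz hnt
      have := uy g hg e heC (nmt y g z (by rw [hgz, hz'])) hey
      rw [← this]; exact hgz
    have hemt : e ∈ mt C x := by
      by_contra h
      have := ux e heC e' heC' h hex'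
      rw [this, hei', hi] at hei
      exact cne _ hei
    have hcross : ∀ c ∈ mt C x, c ≠ e → ∀ k, y k = compl4 (x k) → c k ≠ x k := by
      intro c hc hne k hk hck
      exact hne (uy c (mt_sub _ _ hc) e heC (nmt y c k (by rw [hck, hk, cc])) hey)
    have hexx : e ≠ x := fun h => hxC (h ▸ heC)
    obtain ⟨j0, hj0⟩ : ∃ j0, e j0 ≠ x j0 := by
      by_contra h
      push Not at h
      exact hexx (funext h)
    have hj0i : j0 ≠ i := fun h => hj0 (h ▸ hei)
    have hj0z : j0 ≠ z := fun h => hj0 (h ▸ hez)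
    obtain ⟨t1, hp1, ht1⟩ := ext_t (Finset.mem_filter.1 hemt).2
    let P : Wd (m+1) → Prop := fun t => Pt x t ∧ t j0 = compl4 (e j0)
    have cell : ∀ t, P t → ∃ c ∈ (mt C x).erase e, In c x t ∧ c i = t i ∧ c z = t z := by
      rintro t ⟨hp, htj⟩
      obtain ⟨c, hc, hin⟩ := hx t hp
      have hne : c ≠ e := by
        rintro rfl
        rcases hin j0 with h | h
        · exact hj0 h
        · rw [htj] at h; exact cne _ h.symm
      have hcm := in_mt hc hp hin
      refine ⟨c, Finset.mem_erase.2 ⟨hne, hcm⟩, hin, ?_, ?_⟩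
      · exact (hin i).resolve_left (hcross c hcm hne i hi)
      · exact (hin z).resolve_left (hcross c hcm hne z hz)
    let t0 := flip t1 {j0}
    have hP0 : P t0 := ⟨flip_pt hp1 _, by
      change flip t1 {j0} j0 = _
      rw [flip_same, ht1 j0 hj0]⟩
    have Pflip : ∀ t, P t → ∀ k, k ≠ j0 → P (flip t {k}) := fun t ht k hk =>
      ⟨flip_pt ht.1 _, by rw [flip_off _ hk.symm]; exact ht.2⟩
    have hcard4 : ((mt C x).erase e).card ≤ 4 := by
      rw [Finset.card_erase_of_mem hemt]; omega
    let Q : Finset (Fin 4 × Fin 4) :=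
      ({t0 i, compl4 (t0 i)} : Finset (Fin 4)) ×ˢ ({t0 z, compl4 (t0 z)} : Finset (Fin 4))
    have hQ : Q.card = 4 := by
      have : ∀ a : Fin 4, ({a, compl4 a} : Finset (Fin 4)).card = 2 := by decide
      rw [Finset.card_product, this, this]
    have hinj : Set.InjOn (fun c : Wd (m+1) => (c i, c z)) ((mt C x).erase e : Set (Wd (m+1))) := by
      have hsub : Q ⊆ ((mt C x).erase e).image (fun c : Wd (m+1) => (c i, c z)) := by
        rintro ⟨a, b⟩ hab
        simp only [Q, Finset.mem_product, Finset.mem_insert, Finset.mem_singleton] at hab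
        have : ∃ t, P t ∧ t i = a ∧ t z = b := by
          obtain ⟨ha, hb⟩ := hab
          rcases ha with rfl | rfl <;> rcases hb with rfl | rfl
          · exact ⟨t0, hP0, rfl, rfl⟩
          · exact ⟨flip t0 {z}, Pflip _ hP0 z hj0z.symm, flip_off _ hzi.symm, flip_same _ _⟩
          · exact ⟨flip t0 {i}, Pflip _ hP0 i hj0i.symm, flip_same _ _, flip_off _ hzi⟩
          · exact ⟨flip (flip t0 {i}) {z}, Pflip _ (Pflip _ hP0 i hj0i.symm) z hj0z.symm,
              by rw [flip_off _ hzi.symm, flip_same], by rw [flip_same, flip_off _ hzi]⟩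
        obtain ⟨t, ht, rfl, rfl⟩ := this
        obtain ⟨c, hc, _, h1, h2⟩ := cell t ht
        exact Finset.mem_image.2 ⟨c, hc, by rw [h1, h2]⟩
      apply Finset.injOn_of_card_image_eq
      have := Finset.card_le_card hsub
      have := Finset.card_image_le (s := (mt C x).erase e) (f := fun c : Wd (m+1) => (c i, c z))
      omega
    have shape : ∀ t, P t → ∀ c ∈ (mt C x).erase e, In c x t → c i = t i → c z = t z →
        (∀ j, j ≠ i → j ≠ z → j ≠ j0 → c j = x j) ∧ c j0 = t j0 := by
      intro t ht c hc hin h1 h2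
      have s1 : ∀ j, j ≠ i → j ≠ z → j ≠ j0 → c j = x j := by
        intro j ji jz jj
        obtain ⟨d, hd, hid, d1, d2⟩ := cell _ (Pflip t ht j jj)
        have : c = d := hinj hc hd (by
          simp only [h1, h2, d1, d2, flip_off t ji.symm, flip_off t jz.symm])
        subst this
        exact in_both hin hid
      refine ⟨s1, ?_⟩
      rcases hin j0 with h | h
      · exfalso
        obtain ⟨hne, hcm⟩ := Finset.mem_erase.1 hc
        -- point in both
        let T : Wd (m+1) := fun j => if j = i ∨ j = z then t j else t1 j
        have hPT : Pt x T := by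
          intro j
          simp only [T]
          split_ifs
          · exact ht.1 j
          · exact hp1 j
        have hcT : In c x T := by
          intro j
          by_cases ji : j = i
          · subst ji; right; simp [T, h1]
          · by_cases jz : j = z
            · subst jz; right; simp [T, h2]
            · by_cases jj : j = j0
              · subst jj; exact Or.inl h
              · exact Or.inl (s1 j ji jz jj)
        have heT : In e x T := by
          intro j
          by_cases hj : e j = x j
          · exact Or.inl hj
          · right
            have ji : j ≠ i := fun h => hj (h ▸ hei)
            have jz : j ≠ z := fun h => hj (h ▸ hez)
            simp only [T, ji, jz, or_self, if_false]
            exact (ht1 j hj).symm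
        exact hne (code_eq hC (mt_sub _ _ hcm) heC hPT hcT heT)
      · exact h
    obtain ⟨c, hc, hci, c1, c2⟩ := cell t0 hP0
    obtain ⟨d, hd, hdi, d1, d2⟩ := cell _ (Pflip t0 hP0 z hj0z.symm)
    obtain ⟨cs, cj⟩ := shape t0 hP0 c hc hci c1 c2
    obtain ⟨ds, dj⟩ := shape _ (Pflip t0 hP0 z hj0z.symm) d hd hdi d1 d2
    refine hT c (mt_sub _ _ (Finset.mem_erase.1 hc).2) d (mt_sub _ _ (Finset.mem_erase.1 hd).2)
      ⟨z, by rw [d2, flip_same, c2], fun j hj => ?_⟩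
    by_cases ji : j = i
    · subst ji; rw [c1, d1, flip_off _ hj]
    · by_cases jj : j = j0
      · subst jj; rw [cj, dj, flip_off _ hj]
      · rw [cs j ji hj jj, ds j ji hj jj]

theorem bridge {m : ℕ} {V W : Finset (Wd m)} (h : EquivalentCodes compl4 V W) : Eqv V W := by
  intro x t hp
  have hE : ∀ p q s : Fin 4, Cr p q → ((s = p ∨ s = q) ∧ ¬ (compl4 s = p ∨ compl4 s = q)) ∨
      ((compl4 s = p ∨ compl4 s = q) ∧ ¬ (s = p ∨ s = q)) := by decide
  have hES : ∀ j, ({x j, t j} : Set (Fin 4)) ∈ ESet compl4 := by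
    intro j s
    exact hE _ _ s (hp j)
  have key : ∀ U : Finset (Wd m), (∃ v ∈ U, In v x t) ↔
      (fun j => ({x j, t j} : Set (Fin 4))) ∈ CodeReal compl4 U := by
    intro U
    simp only [CodeReal, Set.mem_iUnion]
    constructor
    · rintro ⟨v, hv, hi⟩
      exact ⟨v, hv, fun j => ⟨hES j, hi j⟩⟩
    · rintro ⟨v, hv, hi⟩
      exact ⟨v, hv, fun j => (hi j).2⟩
  rw [key, key, h]

def pts {m : ℕ} (v : Wd m) : Finset (Fin m → Fin 4 × Fin 4) :=
  Fintype.piFinset (fun j => Finset.univ.filter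
    (fun p : Fin 4 × Fin 4 => Cr p.1 p.2 ∧ (v j = p.1 ∨ v j = p.2)))

theorem mem_pts {m : ℕ} {v : Wd m} {g : Fin m → Fin 4 × Fin 4} :
    g ∈ pts v ↔ Pt (fun j => (g j).1) (fun j => (g j).2) ∧
      In v (fun j => (g j).1) (fun j => (g j).2) := by
  simp only [pts, Fintype.mem_piFinset, Finset.mem_filter, Finset.mem_univ, true_and, Pt, In]
  exact forall_and

theorem pts_card {m : ℕ} (v : Wd m) : (pts v).card = 4 ^ m := by
  have : ∀ a : Fin 4, (Finset.univ.filter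
    (fun p : Fin 4 × Fin 4 => Cr p.1 p.2 ∧ (a = p.1 ∨ a = p.2))).card = 4 := by decide
  rw [pts, Fintype.card_piFinset]
  simp [this]

theorem eqv_card {m : ℕ} {V W : Finset (Wd m)} (hV : PolyboxCode compl4 V)
    (hW : PolyboxCode compl4 W) (h : Eqv V W) : V.card = W.card := by
  have key : ∀ U : Finset (Wd m), PolyboxCode compl4 U →
      (U.biUnion pts).card = U.card * 4 ^ m := by
    intro U hU
    rw [Finset.card_biUnion]
    · rw [Finset.sum_congr rfl (fun v _ => pts_card v), Finset.sum_const, smul_eq_mul]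
    · intro u hu v hv hne
      refine Finset.disjoint_left.2 ?_
      intro g hg hg'
      exact hne (code_eq hU hu hv (mem_pts.1 hg).1 (mem_pts.1 hg).2 (mem_pts.1 hg').2)
  have e : V.biUnion pts = W.biUnion pts := by
    ext g
    simp only [Finset.mem_biUnion]
    constructor
    · rintro ⟨v, hv, hg⟩
      obtain ⟨h1, h2⟩ := mem_pts.1 hg
      obtain ⟨w, hw, h3⟩ := (h _ _ h1).1 ⟨v, hv, h2⟩
      exact ⟨w, hw, mem_pts.2 ⟨h1, h3⟩⟩
    · rintro ⟨v, hv, hg⟩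
      obtain ⟨h1, h2⟩ := mem_pts.1 hg
      obtain ⟨w, hw, h3⟩ := (h _ _ h1).2 ⟨v, hv, h2⟩
      exact ⟨w, hw, mem_pts.2 ⟨h1, h3⟩⟩
  have h1 := key V hV
  have h2 := key W hW
  rw [e, h2] at h1
  exact (Nat.eq_of_mul_eq_mul_right (by positivity) h1).symm

theorem one_word {m : ℕ} (hm : m ≤ 5) {V W : Finset (Wd (m+1))} (hV : PolyboxCode compl4 V)
    (hVt : TwinPairFree compl4 V) (hW : PolyboxCode compl4 W) (hWt : TwinPairFree compl4 W)
    (h : Eqv V W) {i : Fin (m+1)} {l s : Fin 4} (hls : Cr l s) {x : Wd m}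
    (e : sl i s V = sl i l W) (hx : sl i s V = {x}) : False := by
  have hxV : x ∈ sl i s V := by rw [hx]; simp
  have hxW : x ∈ sl i l W := e ▸ hxV
  have c1 : CovW (sl i (compl4 l) W) x := cov_opp hW h.symm hls hxW hxV
  have c2 : CovW (sl i (compl4 s) V) x := cov_opp hV h hls.symm hxV hxW
  have n1 : x ∉ sl i (compl4 l) W := fun h' => sl_opp hWt hxW h'
  have n2 : x ∉ sl i (compl4 s) V := fun h' => sl_opp hVt hxV h'
  have claim : ∀ y ∈ sl i (compl4 l) W, ∀ y' ∈ sl i (compl4 s) V, ∀ q t, Pt q t →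
      In y q t → In y' q t → In x q t := by
    intro y hy y' hy' q t hp h1 h2
    obtain ⟨u, hu, hi⟩ := (sl_eqv h i hls.compl_left q t hp).2 ⟨y, Finset.mem_union_left _ hy, h1⟩
    rcases Finset.mem_union.1 hu with hu | hu
    · exact absurd (sl2_dich hV hls.compl_left.compl hu hy') (in_not_dich hp hi h2)
    · rw [hx, Finset.mem_singleton] at hu
      exact hu ▸ hi
  have meet : ∀ y ∈ sl i (compl4 l) W, ∀ y' ∈ sl i (compl4 s) V, ∀ t, Pt x t →
      In y x t → In y' x t → ∀ j, y j ≠ x j → y' j = x j := by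
    intro y hy y' hy' t hp h1 h2 j hj
    by_contra hj'
    have a1 := (h1 j).resolve_left hj
    have a2 := (h2 j).resolve_left hj'
    have hcl : Pt (flip x {j}) t := fun k => by
      unfold flip
      split_ifs
      · exact (hp k).compl_left
      · exact hp k
    have hin : ∀ w : Wd m, In w x t → w j = t j → In w (flip x {j}) t := by
      intro w hw hwj k
      by_cases hk : k = j
      · subst hk; exact Or.inr hwj
      · rw [flip_off _ hk]; exact hw k
    have := claim y hy y' hy' _ t hcl (hin y h1 a1) (hin y' h2 a2) j
    rw [flip_same] at this
    rcases this with h3 | h3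
    · exact cne _ h3.symm
    · exact (hp j).1 h3.symm
  obtain ⟨y, hy, _, hy3⟩ := lemma3 (sl_code hW i _) (sl_tf hWt i _) c1 n1
  obtain ⟨y', hy', _, hy3'⟩ := lemma3 (sl_code hV i _) (sl_tf hVt i _) c2 n2
  have hdj : Disjoint (fx x y) (fx x y') := by
    obtain ⟨t, hp, ht⟩ := ext_t (Finset.mem_filter.1 hy').2
    let T : Wd m := fun j => if y j ≠ x j then y j else t j
    have hPT : Pt x T := by
      intro j
      simp only [T]
      split_ifs with hj
      · exact ⟨hj, (Finset.mem_filter.1 hy).2 j⟩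
      · exact hp j
    have hyT : In y x T := by
      intro j
      by_cases hj : y j = x j
      · exact Or.inl hj
      · right; simp [T, hj]
    obtain ⟨u, hu, hiu⟩ := c2 T hPT
    have hm := meet y (mt_sub _ _ hy) u hu T hPT hyT hiu
    have hut : In u x t := by
      intro j
      by_cases hj : y j = x j
      · have := hiu j
        simpa [T, hj] using this
      · exact Or.inl (hm j hj)
    have hyt : In y' x t := by
      intro j
      by_cases hj : y' j = x j
      · exact Or.inl hj
      · exact Or.inr (ht j hj).symm
    have : u = y' := code_eq (sl_code hV i _) hu (mt_sub _ _ hy') hp hut hyt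
    subst this
    rw [Finset.disjoint_left]
    intro j h1 h2
    exact mem_fx.1 h2 (hm j (mem_fx.1 h1))
  have h1 := Finset.card_union_of_disjoint hdj
  have h2 : (fx x y ∪ fx x y').card ≤ m := by simpa using Finset.card_le_univ (fx x y ∪ fx x y')
  omega

theorem two_words {m : ℕ} {V W : Finset (Wd (m+2))} (hV : PolyboxCode compl4 V)
    (hVt : TwinPairFree compl4 V) (h : Eqv V W) {i : Fin (m+2)} {l s : Fin 4} (hls : Cr l s)
    (e : sl i l V = sl i s W) (h2 : 2 ≤ (sl i l V).card) : 7 ≤ (sl i (compl4 l) V).card := by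
  by_contra hlt
  obtain ⟨x, hx, y, hy, hne⟩ := Finset.one_lt_card.1 (show 1 < (sl i l V).card by omega)
  exact f2 (sl_code hV i _) (sl_tf hVt i _) (by omega)
    (cov_opp hV h hls hx (e ▸ hx)) (cov_opp hV h hls hy (e ▸ hy))
    (fun h' => sl_opp hVt hx h') (fun h' => sl_opp hVt hy h')
    (sl_code hV i _ x hx y hy hne) (sl_tf hVt i _ x hx y hy)

theorem empty_one {m : ℕ} (T : TProp m) {V W : Finset (Wd (m+1))} (hV : PolyboxCode compl4 V)
    (hVt : TwinPairFree compl4 V) (hW : PolyboxCode compl4 W)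
    (h : Eqv V W) {i : Fin (m+1)} {l s : Fin 4} (hls : Cr l s)
    (e : sl i l V = sl i s W) (hs : sl i s V = ∅) (hne : 1 ≤ (sl i l V).card)
    (hc : (sl i (compl4 l) V).card ≤ 10) : False := by
  obtain ⟨x, hx⟩ := Finset.card_pos.1 hne
  have h2 := sl_eqv h i hls.compl_left
  rw [hs, Finset.union_empty] at h2
  have h3 := T _ _ (sl_code hV i _) (sl_tf hVt i _) (sl2_code hW i hls.compl_left) h2 hc
  refine sl_opp hVt hx ?_
  rw [h3, Finset.mem_union]
  exact Or.inr (e ▸ hx)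

theorem final1 {m : ℕ} (hm : m + 1 ≤ 5) (T : TProp (m+1)) {V W : Finset (Wd (m+2))}
    (hV : PolyboxCode compl4 V)
    (hVt : TwinPairFree compl4 V) (hW : PolyboxCode compl4 W) (hWt : TwinPairFree compl4 W)
    (h : Eqv V W) {i : Fin (m+2)} {l s : Fin 4} (hls : Cr l s)
    (eA : sl i l V = sl i s W) (eB : sl i s V = sl i l W) (hc : V.card ≤ 16)
    (h4 : 4 ≤ (sl i l V).card + (sl i s V).card) : 2 ≤ (sl i s V).card := by
  by_contra hlt
  have hA : 1 ≤ (sl i l V).card := by omega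
  have hsp := card_split V i hls
  have q2 := eqv_card (sl2_code hV i hls.compl) (sl2_code hW i hls.compl) (sl_eqv h i hls.compl)
  rw [sl_union_card hV hls.compl, sl_union_card hW hls.compl, ← eB] at q2
  rcases Nat.lt_or_ge 0 (sl i s V).card with hb | hb
  · have : (sl i s V).card = 1 := by omega
    obtain ⟨x, hx⟩ := Finset.card_eq_one.1 this
    exact one_word hm hV hVt hW hWt h hls eB hx
  · have hs : sl i s V = ∅ := Finset.card_eq_zero.1 (by omega)
    have g1 := fun hc' => empty_one T hV hVt hW h hls eA hs hA hc'
    have g2 := fun hc' => empty_one T hW hWt hV h.symm hls.symm eA.symm (eB ▸ hs) (eA ▸ hA) hc'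
    by_contra
    rcases Nat.lt_or_ge 10 (sl i (compl4 l) V).card with k1 | k1
    · rcases Nat.lt_or_ge 10 (sl i (compl4 s) W).card with k2 | k2
      · omega
      · exact g2 k2
    · exact g1 k1

theorem final {m : ℕ} (hm : m + 1 ≤ 5) (T : TProp (m+1)) {V W : Finset (Wd (m+2))}
    (hV : PolyboxCode compl4 V)
    (hVt : TwinPairFree compl4 V) (hW : PolyboxCode compl4 W) (hWt : TwinPairFree compl4 W)
    (hd : Disjoint V W) (h : Eqv V W) {i : Fin (m+2)} {l s : Fin 4} (hls : Cr l s)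
    (hc : V.card ≤ 16) (h4 : 4 ≤ (sl i l V).card + (sl i s V).card)
    (h10 : (sl i l V).card + (sl i s V).card ≤ 10) : Sib V i l s := by
  by_contra hS
  obtain ⟨eA, eB⟩ := swap_slices T hV hVt hW h hd hls hS h10
  have b2 := final1 hm T hV hVt hW hWt h hls eA eB hc h4
  have a2 := final1 hm T hV hVt hW hWt h hls.symm eB eA hc (by omega)
  have k1 := two_words hV hVt h hls eA a2
  have k2 := two_words hW hWt h.symm hls.symm eA.symm (eA ▸ a2)
  have hsp := card_split V i hls
  have q2 := eqv_card (sl2_code hV i hls.compl) (sl2_code hW i hls.compl) (sl_eqv h i hls.compl)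
  rw [sl_union_card hV hls.compl, sl_union_card hW hls.compl, ← eB] at q2
  omega

theorem filt_card {m : ℕ} (V : Finset (Wd (m+1))) (i : Fin (m+1)) {l s : Fin 4} (h : Cr l s) :
    (V.filter (fun v => v i = l ∨ v i = s)).card = (sl i l V).card + (sl i s V).card := by
  rw [sl_card, sl_card, Finset.filter_or, Finset.card_union_of_disjoint]
  rw [Finset.disjoint_left]
  intro v h1 h2
  exact h.1 ((Finset.mem_filter.1 h2).2.symm.trans (Finset.mem_filter.1 h1).2)

theorem main {m : ℕ} (hm : m + 1 ≤ 5) (T : TProp (m+1)) (V W : Finset (Wd (m+2)))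
    (hV : PolyboxCode compl4 V) (hW : PolyboxCode compl4 W)
    (hVt : TwinPairFree compl4 V) (hWt : TwinPairFree compl4 W)
    (hd : Disjoint V W) (h : EquivalentCodes compl4 V W) (hc : V.card ≤ 16)
    (i : Fin (m+2)) (l s : Fin 4) (h1 : l ≠ s) (h2 : l ≠ compl4 s)
    (h4 : 4 ≤ (V.filter (fun v => v i = l ∨ v i = s)).card)
    (h10 : (V.filter (fun v => v i = l ∨ v i = s)).card ≤ 10) :
    ∃ v ∈ V.filter (fun v => v i = l ∨ v i = s),
        ∃ u ∈ V.filter (fun v => v i = l ∨ v i = s), ISiblings compl4 i v u := by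
  have hls : Cr l s := Cr.symm ⟨h1, h2⟩
  rw [filt_card V i hls] at h4 h10
  obtain ⟨v, hv, u, hu, e1, e2, j, hj, h5, h6⟩ :=
    final hm T hV hVt hW hWt hd (bridge h) hls hc h4 h10
  refine ⟨v, Finset.mem_filter.2 ⟨hv, Or.inl e1⟩, u, Finset.mem_filter.2 ⟨hu, Or.inr e2⟩,
    ⟨j, h5⟩, ?_, ?_, j, hj, h5, h6⟩
  · rw [e1, e2]; exact h1
  · rw [e1, e2]; exact h2

end PB

/-- Let `d ∈ {5,6}` and let `V, W ⊆ {a,a',b,b'}^d` be disjoint equivalent polybox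
codes without twin pairs, `|V| ∈ {13,...,16}`. For all `i ∈ [d]` and `l, s ∈ S`
with `l ∉ {s, s'}`, if `4 ≤ |V^{i,l} ∪ V^{i,s}| ≤ 10`, then `V^{i,l} ∪ V^{i,s}`
contains a pair of `i`-siblings. -/
theorem siblings_exist (d : ℕ) (hd : d = 5 ∨ d = 6)
    (V W : Finset (Fin d → Fin 4))
    (hVcode : PolyboxCode compl4 V) (hWcode : PolyboxCode compl4 W)
    (hVtp : TwinPairFree compl4 V) (hWtp : TwinPairFree compl4 W)
    (hdisj : Disjoint V W) (hequiv : EquivalentCodes compl4 V W)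
    (hcard : 13 ≤ V.card ∧ V.card ≤ 16) :
    ∀ (i : Fin d) (l s : Fin 4), l ≠ s → l ≠ compl4 s →
      4 ≤ (V.filter (fun v => v i = l ∨ v i = s)).card →
      (V.filter (fun v => v i = l ∨ v i = s)).card ≤ 10 →
      ∃ v ∈ V.filter (fun v => v i = l ∨ v i = s),
        ∃ u ∈ V.filter (fun v => v i = l ∨ v i = s), ISiblings compl4 i v u := by
  intro i l s h1 h2 h4 h10
  rcases hd with rfl | rfl
  · exact PB.main (m := 3) (by omega) PB.T4 V W hVcode hWcode hVtp hWtp hdisj hequiv hcard.2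
      i l s h1 h2 h4 h10
  · exact PB.main (m := 4) (by omega) PB.T5 V W hVcode hWcode hVtp hWtp hdisj hequiv hcard.2
      i l s h1 h2 h4 h10
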